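/- As z → +∞ along the positive reals, a_{L1}(λ,z) = (e^{−iβ}/(2π)) · (−κ₊/a₊)^{i λ⁺/κ₊} · (κ₋/a₋)^{−i λ⁻/κ₋} · Γ(1/2 − i λ⁻/κ₋) · Γ(1/2 + i λ⁺/κ₊) · (z/2)^{i(λ⁻/κ₋ − λ⁺/κ₊)} · e^{zA} · (1 + o(1)), where Γ denotes the complex Gamma function, λ⁻ = λ − Ω₋, λ⁺ = λ − Ω₊, and complex powers of positive reals are principal. -/

import Mathlib

open MeasureTheory Set Filter

noncomputable def Cfun (c : ℝ → ℝ) (Omegam K : ℝ) (x : ℝ) : ℝ :=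
  (∫ s in Iic x, (c s - Omegam)) + Omegam * x + K

noncomputable def qfun (a c : ℝ → ℝ) (Omegam K : ℝ) (x : ℝ) : ℂ :=
  (a x : ℂ) * Complex.exp (2 * Complex.I * ((Cfun c Omegam K x : ℝ) : ℂ))

noncomputable def betaC (c : ℝ → ℝ) (Omegam Omegap : ℝ) : ℝ :=
  (∫ s in Iic (0 : ℝ), (c s - Omegam)) + ∫ s in Ioi (0 : ℝ), (c s - Omegap)

noncomputable def mL3 (q : ℝ → ℂ) (lam : ℝ) : ℕ → ℝ → ℂ
  | 0, x =>
      Complex.I * (∫ y in Ioi x,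
        Complex.exp (2 * Complex.I * (lam : ℂ) * ((y : ℂ) - (x : ℂ))) * (starRingEnd ℂ) (q y))
  | n + 1, x =>
      ∫ y in Ioi x, (∫ t in Ioi y,
        Complex.exp (2 * Complex.I * (lam : ℂ) * ((y : ℂ) - (x : ℂ))) * (starRingEnd ℂ) (q y) *
          q t * mL3 q lam n t)

noncomputable def ML3 (q : ℝ → ℂ) (lam : ℝ) (x : ℝ) (z : ℂ) : ℂ :=
  ∑' n : ℕ, mL3 q lam n x * z ^ (2 * n + 1)

noncomputable def aL1 (q : ℝ → ℂ) (lam : ℝ) (z : ℂ) : ℂ :=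
  1 - Complex.I * z * (∫ x : ℝ, q x * ML3 q lam x z)


section helpers
open Topology

lemma DBf {f f' : ℝ → ℂ} {G g : ℝ → ℝ} {x0 x1 : ℝ} (h01 : x0 ≤ x1)
    (hf : ∀ y, x0 ≤ y → y ≤ x1 → HasDerivAt f (f' y) y)
    (hG : ∀ y, x0 ≤ y → y ≤ x1 → HasDerivAt G (-(g y)) y)
    (hb : ∀ y, x0 ≤ y → y ≤ x1 → ‖f' y‖ ≤ g y) :
    ‖f x0 - f x1‖ ≤ G x0 - G x1 := by
  have := image_norm_le_of_norm_deriv_right_le_deriv_boundary' (f := fun y => f y - f x0)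
    (f' := f') (a := x0) (b := x1) (B := fun y => G x0 - G y) (B' := g)
    (fun y hy => ((hf y hy.1 hy.2).sub_const _).continuousAt.continuousWithinAt)
    (fun y hy => ((hf y hy.1 hy.2.le).sub_const _).hasDerivWithinAt)
    (by simp)
    (fun y hy => ((hG y hy.1 hy.2).const_sub _).continuousAt.continuousWithinAt)
    (fun y hy => by
      have := ((hG y hy.1 hy.2.le).const_sub (G x0)).hasDerivWithinAt (s := Ici y)
      simpa using this)
    (fun y hy => hb y hy.1 hy.2.le)
  have := this (right_mem_Icc.2 h01)
  rw [norm_sub_rev]; exact this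

lemma DB {f f' : ℝ → ℂ} {G g : ℝ → ℝ} {x0 : ℝ} {L : ℂ}
    (hf : ∀ y, x0 ≤ y → HasDerivAt f (f' y) y)
    (hG : ∀ y, x0 ≤ y → HasDerivAt G (-(g y)) y)
    (hb : ∀ y, x0 ≤ y → ‖f' y‖ ≤ g y)
    (hfl : Tendsto f atTop (𝓝 L)) {G0 : ℝ} (hGl : Tendsto G atTop (𝓝 G0)) :
    ‖f x0 - L‖ ≤ G x0 - G0 := by
  have h1 : Tendsto (fun x1 => ‖f x0 - f x1‖) atTop (𝓝 ‖f x0 - L‖) :=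
    (tendsto_const_nhds.sub hfl).norm
  have h2 : Tendsto (fun x1 => G x0 - G x1) atTop (𝓝 (G x0 - G0)) :=
    tendsto_const_nhds.sub hGl
  refine le_of_tendsto_of_tendsto h1 h2 ?_
  filter_upwards [eventually_ge_atTop x0] with x1 hx1
  exact DBf hx1 (fun y h _ => hf y h) (fun y h _ => hG y h) (fun y h _ => hb y h)

lemma bdd_Ici {H : ℝ → ℝ} {l : ℝ} (hc : ∀ x, 0 ≤ x → ContinuousAt H x)
    (hl : Tendsto H atTop (𝓝 l)) : ∃ B, ∀ x, 0 ≤ x → H x ≤ B := by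
  obtain ⟨X, hX⟩ := eventually_atTop.1 (hl.eventually_lt_const (lt_add_one l))
  obtain ⟨B, hB⟩ := (isCompact_Icc (a := (0:ℝ)) (b := max X 0)).bddAbove_image (f := H)
    (fun x hx => (hc x hx.1).continuousWithinAt)
  refine ⟨max B (l+1), fun x hx => ?_⟩
  by_cases h : x ≤ max X 0
  · exact le_max_of_le_left (hB ⟨x, ⟨hx, h⟩, rfl⟩)
  · push Not at h
    exact le_max_of_le_right (hX x ((le_max_left _ _).trans h.le)).le

/-- per-z bounds -/
lemma half_z (μ M c1 c2 z : ℝ) (hM : 0 ≤ M) (hc1 : 0 < c1) (hz : 0 < z)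
    (a d s R : ℝ → ℝ) (ha : ∀ x, 0 < a x) (hs : ∀ x, 0 < s x)
    (hs' : ∀ x, HasDerivAt s (-(a x)) x) (hsl : Tendsto s atTop (𝓝 0))
    (hR' : ∀ x, HasDerivAt R (-(d x - μ * a x / s x)) x) (hRl : Tendsto R atTop (𝓝 0))
    (hb : ∀ x, 0 ≤ x → |d x - μ * a x / s x| ≤ M * a x)
    (u w u0 w0 : ℝ → ℂ)
    (hu : ∀ x, HasDerivAt u (-z * a x * w x) x)
    (hw : ∀ x, HasDerivAt w (2 * Complex.I * d x * w x - z * a x * u x) x)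
    (hul : Tendsto u atTop (𝓝 1)) (hwl : Tendsto w atTop (𝓝 0))
    (hu0 : ∀ x, HasDerivAt u0 (-z * a x * w0 x) x)
    (hw0 : ∀ x, HasDerivAt w0 (2 * Complex.I * (μ * a x / s x) * w0 x - z * a x * u0 x) x)
    (hul0 : Tendsto u0 atTop (𝓝 1)) (hwl0 : Tendsto w0 atTop (𝓝 0))
    (hlow : ∀ x, c1 * Real.exp (z * s x) ≤ ‖u0 x‖) (hup : ∀ x, ‖u0 x‖ ≤ c2 * Real.exp (z * s x))
    (hwu : ∀ x, ‖w0 x‖ ≤ ‖u0 x‖)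
    (H P : ℝ → ℂ) (hH : H = fun x => Complex.exp (Complex.I * R x) * u x / u0 x)
    (hP : P = fun x => z * (Complex.exp (Complex.I * R x) * (u x * w0 x - w x * u0 x)) / (u0 x)^2)
    (L : ℝ) (hL : L = 2 * M * (1 + c2^2/c1^2) + 1) :
    (∀ x, HasDerivAt H (-Complex.I * ((d x : ℂ) - μ * a x / s x) * H x + a x * P x) x) ∧
    (∀ x, HasDerivAt P (2 * z * (w0 x / u0 x) *
        (-Complex.I * ((d x : ℂ) - μ * a x / s x) * H x + a x * P x)
        + Complex.I * (((d x : ℂ) - μ * a x / s x) + 2 * μ * a x / s x) * P x) x) ∧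
    Tendsto H atTop (𝓝 1) ∧
    (∀ x, 0 ≤ x → ‖H x‖ ≤ 2 * Real.exp (L * s 0)) ∧
    (∀ x, 0 ≤ x → ‖P x‖ ≤ M * c2^2/c1^2 * (2 * Real.exp (L * s 0))) ∧
    (∀ x, 0 ≤ x → ‖H x - 1‖ ≤ Real.exp (L * s x) - 1) := by
  have hu0ne : ∀ x, u0 x ≠ 0 := fun x h => by
    have := hlow x
    rw [h, norm_zero] at this
    have : 0 < c1 * Real.exp (z * s x) := by positivity
    linarith
  have hsne : ∀ x, (s x : ℂ) ≠ 0 := fun x => by exact_mod_cast (hs x).ne'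
  set E : ℝ → ℂ := fun x => Complex.exp (Complex.I * R x) with hE
  have hE' : ∀ x, HasDerivAt E (-Complex.I * ((d x : ℂ) - μ * a x / s x) * E x) x := fun x => by
    have h1 : HasDerivAt (fun x => ((R x : ℝ):ℂ)) ((-(d x - μ * a x / s x) : ℝ) : ℂ) x :=
      (hR' x).ofReal_comp
    have := (h1.const_mul Complex.I).cexp
    convert this using 1
    simp only [hE]; push_cast; ring
  have hEn : ∀ x, ‖E x‖ = 1 := fun x => by
    simp only [hE]; rw [mul_comm]; exact Complex.norm_exp_ofReal_mul_I _
  have hEl : Tendsto E atTop (𝓝 1) := by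
    have : Tendsto (fun x => Complex.exp (Complex.I * R x)) atTop
        (𝓝 (Complex.exp (Complex.I * (0:ℝ)))) := by
      refine (Complex.continuous_exp.tendsto _).comp (tendsto_const_nhds.mul ?_)
      exact (Complex.continuous_ofReal.tendsto _).comp hRl
    simpa using this
  have hH1 : ∀ x, HasDerivAt H (-Complex.I * ((d x : ℂ) - μ * a x / s x) * H x + a x * P x) x := by
    intro x
    have := ((hE' x).mul (hu x)).div (hu0 x) (hu0ne x)
    have e1 : H = (E * u) / u0 := by rw [hH]; rfl
    rw [← e1] at this
    refine this.congr_deriv ?_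
    rw [hP, hH]
    simp only [Pi.mul_apply]
    symm
    have := hu0ne x
    have := hsne x
    change _ * (_) * (E x * u x / u0 x) + _ * (z * (E x * _) / _) = _
    field_simp
    ring
  set N : ℝ → ℂ := fun x => E x * (u x * w0 x - w x * u0 x) with hN
  have hN' : ∀ x, HasDerivAt N (Complex.I * (((d x : ℂ) - μ * a x / s x) + 2 * μ * a x / s x) * N x
      - 2 * Complex.I * ((d x : ℂ) - μ * a x / s x) * (E x * u x * w0 x)) x := by
    intro x
    have := (hE' x).mul (((hu x).mul (hw0 x)).sub ((hw x).mul (hu0 x)))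
    refine HasDerivAt.congr_deriv this ?_
    simp only [hN, Pi.mul_apply, Pi.sub_apply]
    have := hsne x
    field_simp
    ring
  have hP1 : ∀ x, HasDerivAt P (2 * z * (w0 x / u0 x) *
        (-Complex.I * ((d x : ℂ) - μ * a x / s x) * H x + a x * P x)
        + Complex.I * (((d x : ℂ) - μ * a x / s x) + 2 * μ * a x / s x) * P x) x := by
    intro x
    have h := ((hN' x).const_mul (z:ℂ)).div ((hu0 x).pow 2) (pow_ne_zero 2 (hu0ne x))
    have e1 : P = fun x => (z * N x) / (u0 x)^2 := by rw [hP]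
    have e2 : P = (fun y => (z : ℂ) * N y) / u0 ^ 2 := e1
    rw [← e2] at h
    refine h.congr_deriv ?_
    symm
    rw [e1, hH]
    have := hu0ne x
    have := hsne x
    change _ * (_ * _ * (E x * u x / u0 x) + _) + _ = _
    simp only [hN, Pi.pow_apply]
    field_simp
    ring
  have hHl : Tendsto H atTop (𝓝 1) := by
    have := (hEl.mul hul).div hul0 one_ne_zero
    rw [hH]
    rw [one_mul, div_one] at this
    exact this
  have hNl : Tendsto N atTop (𝓝 0) := by
    have := hEl.mul ((hul.mul hwl0).sub (hwl.mul hul0))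
    simpa using this
  -- rotated N
  set F : ℝ → ℂ := fun x => Complex.exp (Complex.I * (R x + 2 * μ * Real.log (s x) : ℝ)) with hF
  have hFn : ∀ x, ‖F x‖ = 1 := fun x => by
    simp only [hF]; rw [mul_comm]; exact Complex.norm_exp_ofReal_mul_I _
  have hF' : ∀ x, HasDerivAt F
      (-Complex.I * (((d x : ℂ) - μ * a x / s x) + 2 * μ * a x / s x) * F x) x := fun x => by
    have h1 := ((hR' x).add (((hs' x).log (hs x).ne').const_mul (2 * μ))).ofReal_comp
    have := (h1.const_mul Complex.I).cexp
    refine HasDerivAt.congr_deriv this ?_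
    simp only [hF, Pi.add_apply]; push_cast; ring
  have hFN : ∀ x, HasDerivAt (fun x => F x * N x)
      (- 2 * Complex.I * ((d x : ℂ) - μ * a x / s x) * (F x * E x * u x * w0 x)) x := fun x => by
    refine ((hF' x).mul (hN' x)).congr_deriv ?_
    ring
  have hFNl : Tendsto (fun x => F x * N x) atTop (𝓝 0) := by
    rw [tendsto_zero_iff_norm_tendsto_zero] at hNl ⊢
    simpa [hFn] using hNl
  have hsmono : Antitone s := antitone_of_hasDerivAt_nonpos hs' (fun x => by have := ha x; simp; linarith)
  have hc2 : 0 < c2 := by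
    have h1 := (hlow 0).trans (hup 0)
    have := Real.exp_pos (z * s 0)
    nlinarith
  have hLpos : 0 < L := by rw [hL]; positivity
  have hHu : ∀ x, ‖E x * u x‖ = ‖H x‖ * ‖u0 x‖ := fun x => by
    rw [← norm_mul, hH]; simp only; rw [div_mul_cancel₀ _ (hu0ne x)]
  have hdn : ∀ x, 0 ≤ x → ‖((d x : ℂ) - μ * a x / s x)‖ ≤ M * a x := fun x hx => by
    have := hb x hx
    rw [← Real.norm_eq_abs, ← Complex.norm_real] at this
    simpa using this
  -- key step for P
  have stepP : ∀ β : ℝ, 0 ≤ β → (∀ x, 0 ≤ x → ‖H x‖ ≤ β * Real.exp (L * s x)) →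
      ∀ x, 0 ≤ x → ‖P x‖ ≤ M * c2^2/c1^2 * (β * Real.exp (L * s x)) := by
    intro β hβ hHβ x hx
    have key : ‖F x * N x - 0‖ ≤ (M * (β * Real.exp (L * s x)) * c2^2 / z) * Real.exp (2 * z * s x) -
        (M * (β * Real.exp (L * s x)) * c2^2 / z) * Real.exp (2 * z * 0) := by
      refine DB (f' := fun x => - 2 * Complex.I * ((d x : ℂ) - μ * a x / s x) * (F x * E x * u x * w0 x))
        (G := fun y => (M * (β * Real.exp (L * s x)) * c2^2 / z) * Real.exp (2 * z * s y))
        (g := fun y => 2 * M * a y * (β * Real.exp (L * s x)) * c2^2 * Real.exp (2 * z * s y))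
        (fun y _ => hFN y) (fun y _ => ?_) (fun y hy => ?_) hFNl ?_
      · have := (((hs' y).const_mul (2*z)).exp).const_mul (M * (β * Real.exp (L * s x)) * c2^2 / z)
        refine this.congr_deriv ?_
        field_simp
      · have e1 : ‖F y * E y * u y * w0 y‖ = ‖H y‖ * ‖u0 y‖ * ‖w0 y‖ := by
          rw [← hHu, mul_assoc (F y), norm_mul, norm_mul (F y), hFn, one_mul]
        rw [norm_mul, norm_mul, e1]
        have e2 : ‖(-2 * Complex.I : ℂ)‖ = 2 := by simp
        rw [e2]
        have hy0 := hx.trans hy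
        have b1 : ‖H y‖ ≤ β * Real.exp (L * s x) := (hHβ y hy0).trans (by
          have := hsmono hy
          gcongr)
        have b2 := hdn y hy0
        have b3 : ‖u0 y‖ * ‖w0 y‖ ≤ (c2 * Real.exp (z * s y)) * (c2 * Real.exp (z * s y)) := by
          have := hup y
          have := (hwu y).trans (hup y)
          gcongr
        have e3 : (c2 * Real.exp (z * s y)) * (c2 * Real.exp (z * s y)) = c2^2 * Real.exp (2 * z * s y) := by
          rw [show 2 * z * s y = z * s y + z * s y by ring, Real.exp_add]; ring
        rw [e3] at b3
        have := ha y
        calc 2 * ‖((d y : ℂ) - μ * a y / s y)‖ * (‖H y‖ * ‖u0 y‖ * ‖w0 y‖)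
            = 2 * ‖((d y : ℂ) - μ * a y / s y)‖ * (‖H y‖ * (‖u0 y‖ * ‖w0 y‖)) := by ring
          _ ≤ 2 * (M * a y) * ((β * Real.exp (L * s x)) * (c2^2 * Real.exp (2 * z * s y))) := by
              gcongr
          _ = _ := by ring
      · refine tendsto_const_nhds.mul ((Real.continuous_exp.tendsto _).comp (tendsto_const_nhds.mul hsl))
    rw [sub_zero, norm_mul, hFn, one_mul] at key
    have key2 : ‖N x‖ ≤ (M * (β * Real.exp (L * s x)) * c2^2 / z) * Real.exp (2 * z * s x) := by
      refine key.trans ?_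
      have : 0 ≤ (M * (β * Real.exp (L * s x)) * c2^2 / z) * Real.exp (2 * z * 0) := by positivity
      linarith
    have hPn : ‖P x‖ = z * ‖N x‖ / ‖u0 x‖^2 := by
      rw [hP]; simp only [norm_div, norm_pow]
      rw [norm_mul, Complex.norm_real, Real.norm_of_nonneg hz.le]
    have hl2 : c1^2 * Real.exp (2 * z * s x) ≤ ‖u0 x‖^2 := by
      have e3 : (c1 * Real.exp (z * s x))^2 = c1^2 * Real.exp (2 * z * s x) := by
        rw [show 2 * z * s x = z * s x + z * s x by ring, Real.exp_add]; ring
      rw [← e3]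
      have := hlow x
      gcongr
    rw [hPn]
    calc z * ‖N x‖ / ‖u0 x‖^2 ≤ z * ((M * (β * Real.exp (L * s x)) * c2^2 / z) * Real.exp (2 * z * s x)) / (c1^2 * Real.exp (2 * z * s x)) := by
          gcongr
      _ = _ := by field_simp
  have stepH : ∀ β : ℝ, 0 ≤ β → (∀ x, 0 ≤ x → ‖H x‖ ≤ β * Real.exp (L * s x)) →
      ∀ x, 0 ≤ x → ‖H x - 1‖ ≤ β / 2 * (Real.exp (L * s x) - 1) := by
    intro β hβ hHβ x hx
    have key : ‖H x - 1‖ ≤ β / 2 * Real.exp (L * s x) - β / 2 * Real.exp (L * 0) := by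
      refine DB (f' := fun x => -Complex.I * ((d x : ℂ) - μ * a x / s x) * H x + a x * P x)
        (G := fun y => β / 2 * Real.exp (L * s y)) (g := fun y => L * a y * (β / 2 * Real.exp (L * s y)))
        (fun y _ => hH1 y) (fun y _ => ?_) (fun y hy => ?_) hHl ?_
      · have := (((hs' y).const_mul L).exp).const_mul (β / 2)
        refine this.congr_deriv ?_
        ring
      · have hy0 := hx.trans hy
        have b1 := hHβ y hy0
        have b2 := hdn y hy0
        have b3 := stepP β hβ hHβ y hy0
        have := ha y
        refine (norm_add_le _ _).trans ?_
        rw [norm_mul, norm_mul, norm_mul, norm_neg, Complex.norm_I, one_mul, Complex.norm_real,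
          Real.norm_of_nonneg this.le]
        calc _ ≤ M * a y * (β * Real.exp (L * s y)) + a y * (M * c2^2/c1^2 * (β * Real.exp (L * s y))) := by
              gcongr
          _ = (2 * M * (1 + c2^2/c1^2)) * a y * (β / 2 * Real.exp (L * s y)) := by ring
          _ ≤ _ := by
              gcongr; rw [hL]; linarith
      · refine tendsto_const_nhds.mul ((Real.continuous_exp.tendsto _).comp (tendsto_const_nhds.mul hsl))
    refine key.trans (le_of_eq ?_)
    simp; ring
  -- sup
  have hbdd : ∃ B, ∀ x, 0 ≤ x → ‖H x‖ * Real.exp (-(L * s x)) ≤ B := by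
    refine bdd_Ici (l := ‖(1:ℂ)‖ * Real.exp (-(L * 0))) (fun x _ => ?_) ?_
    · exact (hH1 x).continuousAt.norm.mul ((continuousAt_const.mul (hs' x).continuousAt).neg.rexp)
    · exact hHl.norm.mul ((Real.continuous_exp.tendsto _).comp (tendsto_const_nhds.mul hsl).neg)
  set S : Set ℝ := (fun x => ‖H x‖ * Real.exp (-(L * s x))) '' Ici 0 with hS
  have hSb : BddAbove S := by
    obtain ⟨B, hB⟩ := hbdd
    refine ⟨B, ?_⟩
    rintro _ ⟨x, hx, rfl⟩
    exact hB x hx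
  have hSne : S.Nonempty := ⟨_, 0, by simp, rfl⟩
  have hβ1 : ∀ x, 0 ≤ x → ‖H x‖ ≤ sSup S * Real.exp (L * s x) := fun x hx => by
    have : ‖H x‖ * Real.exp (-(L * s x)) ≤ sSup S := le_csSup hSb ⟨x, hx, rfl⟩
    rw [Real.exp_neg] at this
    have hp := Real.exp_pos (L * s x)
    rwa [← div_eq_mul_inv, div_le_iff₀ hp] at this
  have hβ0 : 0 ≤ sSup S := by
    have := (norm_nonneg _).trans (hβ1 0 le_rfl)
    have hp := Real.exp_pos (L * s 0)
    exact nonneg_of_mul_nonneg_left this hp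
  have hβ2 : sSup S ≤ 1 + sSup S / 2 := by
    refine csSup_le hSne ?_
    rintro _ ⟨x, hx, rfl⟩
    have h1 := stepH _ hβ0 hβ1 x hx
    have h2 : ‖H x‖ ≤ 1 + sSup S / 2 * (Real.exp (L * s x) - 1) := by
      have := norm_le_norm_add_norm_sub' (H x) 1
      rw [norm_one] at this
      linarith
    have hp := Real.exp_pos (L * s x)
    have h1e : 1 ≤ Real.exp (L * s x) := Real.one_le_exp (by have := hs x; positivity)
    simp only
    rw [Real.exp_neg, ← div_eq_mul_inv, div_le_iff₀ hp]
    nlinarith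
  have hβ3 : sSup S ≤ 2 := by linarith
  have hfin : ∀ x, 0 ≤ x → ‖H x‖ ≤ 2 * Real.exp (L * s x) := fun x hx =>
    (hβ1 x hx).trans (by gcongr)
  refine ⟨hH1, hP1, hHl, ?_, ?_, ?_⟩
  · intro x hx
    refine (hfin x hx).trans ?_
    have := hsmono hx
    gcongr
  · intro x hx
    refine (stepP 2 (by norm_num) hfin x hx).trans ?_
    have := hsmono hx
    gcongr
  · intro x hx
    refine (stepH 2 (by norm_num) hfin x hx).trans (by simp)


lemma half (μ M c1 c2 : ℝ) (hM : 0 ≤ M) (hc1 : 0 < c1) (U W : ℝ → ℂ)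
    (hU : ∀ t, 0 < t → HasDerivAt U (W t) t)
    (hW : ∀ t : ℝ, 0 < t → HasDerivAt W (U t - 2 * Complex.I * μ / t * W t) t)
    (hlow : ∀ t, 0 < t → c1 * Real.exp t ≤ ‖U t‖) (hup : ∀ t, 0 < t → ‖U t‖ ≤ c2 * Real.exp t)
    (hWU : ∀ t, 0 < t → ‖W t‖ ≤ ‖U t‖)
    (hU0 : Tendsto U (𝓝[>] 0) (𝓝 1)) (hW0 : Tendsto W (𝓝[>] 0) (𝓝 0))
    (hy : Tendsto (fun t => W t / U t) atTop (𝓝 1))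
    (a d s R : ℝ → ℝ) (ha : ∀ x, 0 < a x) (hs : ∀ x, 0 < s x)
    (hs' : ∀ x, HasDerivAt s (-(a x)) x) (hsl : Tendsto s atTop (𝓝 0))
    (hR' : ∀ x, HasDerivAt R (-(d x - μ * a x / s x)) x) (hRl : Tendsto R atTop (𝓝 0))
    (hb : ∀ x, 0 ≤ x → |d x - μ * a x / s x| ≤ M * a x)
    (u w : ℝ → ℝ → ℂ)
    (hu : ∀ z x : ℝ, HasDerivAt (u z) (-z * a x * w z x) x)
    (hw : ∀ z x : ℝ, HasDerivAt (w z) (2 * Complex.I * d x * w z x - z * a x * u z x) x)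
    (hul : ∀ z, Tendsto (u z) atTop (𝓝 1)) (hwl : ∀ z, Tendsto (w z) atTop (𝓝 0)) :
    Tendsto (fun z => Complex.exp (Complex.I * R 0) * u z 0 / U (z * s 0)) atTop (𝓝 1) ∧
    Tendsto (fun z => Complex.exp (Complex.I * R 0) * w z 0 / U (z * s 0)) atTop (𝓝 1) := by
  set L := 2 * M * (1 + c2^2/c1^2) + 1 with hL
  set B := 2 * Real.exp (L * s 0) with hB
  set Kc := M * c2^2/c1^2 with hKc
  have hLpos : 0 < L := by positivity
  have hBpos : 0 < B := by positivity
  have hKpos : 0 ≤ Kc := by positivity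
  have hUne : ∀ t, 0 < t → U t ≠ 0 := fun t ht h => by
    have := hlow t ht
    rw [h, norm_zero] at this
    have : 0 < c1 * Real.exp t := by positivity
    linarith
  have hsmono : Antitone s := antitone_of_hasDerivAt_nonpos hs' (fun x => by have := ha x; simp; linarith)
  have main : ∀ z : ℝ, 0 < z → _ := fun z hz =>
    half_z μ M c1 c2 z hM hc1 hz a d s R ha hs hs' hsl hR' hRl hb (u z) (w z)
      (fun x => U (z * s x)) (fun x => W (z * s x)) (hu z) (hw z) (hul z) (hwl z)
      (fun x => by
        have h1 := (hU (z * s x) (mul_pos hz (hs x))).scomp x ((hs' x).const_mul z)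
        refine h1.congr_deriv ?_
        simp [mul_assoc])
      (fun x => by
        have h1 := (hW (z * s x) (mul_pos hz (hs x))).scomp x ((hs' x).const_mul z)
        refine h1.congr_deriv ?_
        have h2 : (z:ℂ) ≠ 0 := by exact_mod_cast hz.ne'
        have h3 : (s x:ℂ) ≠ 0 := by exact_mod_cast (hs x).ne'
        rw [Complex.real_smul]
        push_cast
        field_simp
        ring)
      (by
        refine hU0.comp (tendsto_nhdsWithin_iff.2 ⟨?_, ?_⟩)
        · simpa using hsl.const_mul z
        · exact Eventually.of_forall fun x => mul_pos hz (hs x))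
      (by
        refine hW0.comp (tendsto_nhdsWithin_iff.2 ⟨?_, ?_⟩)
        · simpa using hsl.const_mul z
        · exact Eventually.of_forall fun x => mul_pos hz (hs x))
      (fun x => hlow _ (mul_pos hz (hs x))) (fun x => hup _ (mul_pos hz (hs x)))
      (fun x => hWU _ (mul_pos hz (hs x))) _ _ rfl rfl L hL
  set H : ℝ → ℝ → ℂ := fun z x => Complex.exp (Complex.I * R x) * u z x / U (z * s x) with hH
  set P : ℝ → ℝ → ℂ := fun z x => z * (Complex.exp (Complex.I * R x) *
    (u z x * W (z * s x) - w z x * U (z * s x))) / (U (z * s x))^2 with hP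
  replace main : ∀ z : ℝ, 0 < z →
      (∀ x, HasDerivAt (H z) (-Complex.I * ((d x : ℂ) - μ * a x / s x) * H z x + a x * P z x) x) ∧
      (∀ x, HasDerivAt (P z) (2 * z * (W (z * s x) / U (z * s x)) *
        (-Complex.I * ((d x : ℂ) - μ * a x / s x) * H z x + a x * P z x)
        + Complex.I * (((d x : ℂ) - μ * a x / s x) + 2 * μ * a x / s x) * P z x) x) ∧
      Tendsto (H z) atTop (𝓝 1) ∧
      (∀ x, 0 ≤ x → ‖H z x‖ ≤ B) ∧
      (∀ x, 0 ≤ x → ‖P z x‖ ≤ Kc * B) ∧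
      (∀ x, 0 ≤ x → ‖H z x - 1‖ ≤ Real.exp (L * s x) - 1) := main
  have hdn : ∀ x, 0 ≤ x → ‖((d x : ℂ) - μ * a x / s x)‖ ≤ M * a x := fun x hx => by
    have := hb x hx
    rw [← Real.norm_eq_abs, ← Complex.norm_real] at this
    simpa using this
  have hzs : Tendsto (fun z : ℝ => z * s 0) atTop atTop :=
    tendsto_id.atTop_mul_const (hs 0)
  have h1 : Tendsto (fun z => H z 0) atTop (𝓝 1) := by
    rw [Metric.tendsto_nhds]
    intro ε hε
    set C := (M + Kc) * B with hC
    have hCn : 0 ≤ C := by positivity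
    set η := ε / (4 * (C * s 0 + 1)) with hη
    have hs0 := hs 0
    have hηpos : 0 < η := by positivity
    -- choose X
    obtain ⟨X, hX0, hX⟩ : ∃ X, 0 ≤ X ∧ Real.exp (L * s X) - 1 < ε / 4 := by
      have : Tendsto (fun x => Real.exp (L * s x) - 1) atTop (𝓝 (Real.exp (L * 0) - 1)) :=
        ((Real.continuous_exp.tendsto _).comp (tendsto_const_nhds.mul hsl)).sub_const 1
      rw [mul_zero, Real.exp_zero, sub_self] at this
      obtain ⟨X, h1, h2⟩ := ((this.eventually_lt_const (by positivity : 0 < ε/4)).and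
        (eventually_ge_atTop 0)).exists
      exact ⟨X, h2, h1⟩
    set Q := Kc * B + s 0 * ((M + 2 * |μ| / s X) * (Kc * B)) with hQ
    have hQz : Tendsto (fun z : ℝ => Q / z) atTop (𝓝 0) := tendsto_const_nhds.div_atTop tendsto_id
    have hyz : ∀ᶠ t in atTop, ‖W t / U t - 1‖ ≤ η := by
      have := (tendsto_iff_norm_sub_tendsto_zero.1 hy).eventually_lt_const hηpos
      exact this.mono fun _ h => h.le
    obtain ⟨T, hT⟩ := eventually_atTop.1 hyz
    filter_upwards [hQz.eventually_lt_const (by positivity : 0 < ε/4), eventually_gt_atTop 0,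
      eventually_ge_atTop (T / s X)] with z hz1 hz hz2
    obtain ⟨hH', hP', hHl, hHb, hPb, hH1⟩ := main z hz
    have hzc : (z:ℂ) ≠ 0 := by exact_mod_cast hz.ne'
    have hF : ∀ y, HasDerivAt (fun x => H z x - P z x / (2 * z))
        ((1 - W (z * s y) / U (z * s y)) * (-Complex.I * ((d y : ℂ) - μ * a y / s y) * H z y + a y * P z y)
        - Complex.I * (((d y : ℂ) - μ * a y / s y) + 2 * μ * a y / s y) * P z y / (2 * z)) y := by
      intro y
      refine ((hH' y).sub ((hP' y).div_const (2 * (z:ℂ)))).congr_deriv ?_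
      generalize H z y = h0
      generalize P z y = p0
      field_simp
      ring
    have key := DBf (G := fun y => (η * C + (M + 2 * |μ| / s X) * (Kc * B) / (2 * z)) * s y)
      (g := fun y => (η * C + (M + 2 * |μ| / s X) * (Kc * B) / (2 * z)) * a y) hX0
      (fun y _ _ => hF y) (fun y _ _ => by
        refine ((hs' y).const_mul _).congr_deriv (by ring)) (fun y hy0 hyX => by
        have b1 := hHb y hy0
        have b2 := hPb y hy0
        have b3 := hdn y hy0
        have hay := ha y
        have hsX : s X ≤ s y := hsmono hyX
        have hsXp := hs X
        have b4 : ‖1 - W (z * s y) / U (z * s y)‖ ≤ η := by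
          rw [norm_sub_rev]
          refine hT _ ?_
          rw [div_le_iff₀ hsXp] at hz2
          exact hz2.trans (by gcongr)
        have b5 : ‖-Complex.I * ((d y : ℂ) - μ * a y / s y) * H z y + a y * P z y‖ ≤ C * a y := by
          refine (norm_add_le _ _).trans ?_
          rw [norm_mul, norm_mul, norm_mul, norm_neg, Complex.norm_I, one_mul, Complex.norm_real,
            Real.norm_of_nonneg hay.le]
          calc _ ≤ M * a y * B + a y * (Kc * B) := by gcongr
            _ = _ := by rw [hC]; ring
        have b6 : ‖(((d y : ℂ) - μ * a y / s y) + 2 * μ * a y / s y)‖ ≤ (M + 2 * |μ| / s X) * a y := by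
          refine (norm_add_le _ _).trans ?_
          have : ‖(2 * μ * a y / s y : ℂ)‖ ≤ 2 * |μ| / s X * a y := by
            rw [norm_div, norm_mul, norm_mul, Complex.norm_real, Complex.norm_real, Complex.norm_real,
              Real.norm_of_nonneg hay.le, Real.norm_of_nonneg (hs y).le]
            calc _ ≤ ‖(2:ℂ)‖ * ‖μ‖ * a y / s X := by gcongr
              _ = _ := by simp; ring
          calc _ ≤ M * a y + 2 * |μ| / s X * a y := by gcongr
            _ = _ := by ring
        refine (norm_sub_le _ _).trans ?_
        rw [norm_mul, norm_div, norm_mul, norm_mul Complex.I, Complex.norm_I, one_mul]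
        have e2 : ‖(2 * z : ℂ)‖ = 2 * z := by
          rw [norm_mul, Complex.norm_real, Real.norm_of_nonneg hz.le]; simp
        rw [e2]
        calc _ ≤ η * (C * a y) + ((M + 2 * |μ| / s X) * a y) * (Kc * B) / (2 * z) := by gcongr
          _ = _ := by ring)
    have hPn : ∀ x, 0 ≤ x → ‖P z x / (2 * z)‖ ≤ Kc * B / (2 * z) := fun x hx => by
      have e2 : ‖(2 * z : ℂ)‖ = 2 * z := by
        rw [norm_mul, Complex.norm_real, Real.norm_of_nonneg hz.le]; simp
      rw [norm_div, e2]
      have := hPb x hx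
      gcongr
    have p0 := hPn 0 le_rfl
    have pX := hPn X hX0
    have hX1 := hH1 X hX0
    have e : H z 0 - 1 = ((H z 0 - P z 0 / (2 * z)) - (H z X - P z X / (2 * z)))
        + P z 0 / (2 * z) - P z X / (2 * z) + (H z X - 1) := by ring
    rw [dist_eq_norm, e]
    have t1 := norm_add_le (((H z 0 - P z 0 / (2 * z)) - (H z X - P z X / (2 * z)))
        + P z 0 / (2 * z) - P z X / (2 * z)) (H z X - 1)
    have t2 := norm_sub_le (((H z 0 - P z 0 / (2 * z)) - (H z X - P z X / (2 * z)))
        + P z 0 / (2 * z)) (P z X / (2 * z))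
    have t3 := norm_add_le ((H z 0 - P z 0 / (2 * z)) - (H z X - P z X / (2 * z))) (P z 0 / (2 * z))
    have hsX := (hs X)
    have k2 : (η * C + (M + 2 * |μ| / s X) * (Kc * B) / (2 * z)) * s 0
      - (η * C + (M + 2 * |μ| / s X) * (Kc * B) / (2 * z)) * s X ≤ 
      η * C * s 0 + s 0 * ((M + 2 * |μ| / s X) * (Kc * B)) / z := by
      have n1 : 0 ≤ (η * C + (M + 2 * |μ| / s X) * (Kc * B) / (2 * z)) * s X := by positivity
      have n2 : 0 ≤ s 0 * ((M + 2 * |μ| / s X) * (Kc * B)) / z := by positivity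
      have : (η * C + (M + 2 * |μ| / s X) * (Kc * B) / (2 * z)) * s 0 = η * C * s 0 +
        (1/2) * (s 0 * ((M + 2 * |μ| / s X) * (Kc * B)) / z) := by field_simp
      linarith
    have k3 : η * C * s 0 ≤ ε / 4 := by
      rw [hη, div_mul_eq_mul_div, div_mul_eq_mul_div, div_le_div_iff₀ (by positivity) (by norm_num)]
      nlinarith [mul_nonneg hCn hs0.le]
    have k4 : Q / z = Kc * B / (2 * z) + Kc * B / (2 * z) + s 0 * ((M + 2 * |μ| / s X) * (Kc * B)) / z := by
      rw [hQ]; field_simp; ring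
    have key' : ‖(H z 0 - P z 0 / (2 * z)) - (H z X - P z X / (2 * z))‖ ≤ _ := key
    linarith
  refine ⟨h1, ?_⟩
  have hPz : Tendsto (fun z : ℝ => P z 0 / z) atTop (𝓝 0) := by
    refine squeeze_zero_norm' (a := fun z => Kc * B / z) ?_ (tendsto_const_nhds.div_atTop tendsto_id)
    filter_upwards [eventually_gt_atTop 0] with z hz
    obtain ⟨-, -, -, -, hPb, -⟩ := main z hz
    have := hPb 0 le_rfl
    rw [norm_div, Complex.norm_real, Real.norm_of_nonneg hz.le]
    gcongr
  have h2 := (h1.mul (hy.comp hzs)).sub hPz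
  rw [one_mul, sub_zero] at h2
  refine h2.congr' ?_
  filter_upwards [eventually_gt_atTop 0] with z hz
  have hn := hUne (z * s 0) (mul_pos hz (hs 0))
  have hzc : (z:ℂ) ≠ 0 := by exact_mod_cast hz.ne'
  simp only [hH, hP, Function.comp]
  field_simp
  ring


noncomputable def phM (μ : ℝ) (v : ℝ) : ℂ := Complex.exp (Complex.I * (μ * Real.log v : ℝ))

lemma phM_norm (μ v : ℝ) : ‖phM μ v‖ = 1 := by
  unfold phM; rw [mul_comm]; exact Complex.norm_exp_ofReal_mul_I _

lemma phM_meas (μ : ℝ) : Measurable (phM μ) := by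
  unfold phM
  exact Complex.measurable_exp.comp ((Complex.measurable_ofReal.comp
    (Real.measurable_log.const_mul μ)).const_mul _)

lemma phM_mul (μ : ℝ) {v w : ℝ} (hv : 0 < v) (hw : 0 < w) : phM μ (v * w) = phM μ v * phM μ w := by
  unfold phM
  rw [← Complex.exp_add, Real.log_mul hv.ne' hw.ne']
  congr 1; push_cast; ring

lemma phM_cont (μ : ℝ) {v : ℝ} (hv : v ≠ 0) : ContinuousAt (phM μ) v := by
  unfold phM
  refine Complex.continuous_exp.continuousAt.comp ?_
  refine continuousAt_const.mul (Complex.continuous_ofReal.continuousAt.comp ?_)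
  exact continuousAt_const.mul (Real.continuousAt_log hv)

lemma phM_one (μ : ℝ) : phM μ 1 = 1 := by simp [phM]

lemma phM_cpow (μ : ℝ) {v : ℝ} (hv : 0 < v) : phM μ v = (v : ℂ) ^ (Complex.I * μ) := by
  rw [Complex.cpow_def_of_ne_zero (by exact_mod_cast hv.ne'), phM, ← Complex.ofReal_log hv.le]
  congr 1; push_cast; ring

noncomputable def gM (ψ : ℝ → ℂ) (t : ℝ) : ℂ := ∫ v in Ioo (0:ℝ) 1, Complex.exp (-2 * t * v) * ψ v

lemma gM_deriv {ψ : ℝ → ℂ} (hm : Measurable ψ) (hb : ∀ v ∈ Ioo (0:ℝ) 1, ‖ψ v‖ ≤ 4) (t : ℝ) :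
    HasDerivAt (gM ψ) (gM (fun v => -2 * v * ψ v) t) t := by
  have hmeas : ∀ t : ℝ, Measurable (fun v : ℝ => Complex.exp (-2 * t * v) * ψ v) := fun t => by
    have : Measurable (fun v : ℝ => Complex.exp (-2 * t * v)) := by fun_prop
    exact this.mul hm
  have hexp : ∀ (t v : ℝ), ‖Complex.exp (-2 * t * v)‖ = Real.exp (-2 * t * v) := fun t v => by
    rw [Complex.norm_exp]; congr 1; simp
  have hint : ∀ C : ℝ, Integrable (fun _ : ℝ => C) (volume.restrict (Ioo (0:ℝ) 1)) := fun C => by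
    refine integrable_const _
  have key := hasDerivAt_integral_of_dominated_loc_of_deriv_le (μ := volume.restrict (Ioo (0:ℝ) 1))
    (F := fun (t : ℝ) (v : ℝ) => Complex.exp (-2 * t * v) * ψ v)
    (F' := fun (t : ℝ) (v : ℝ) => Complex.exp (-2 * t * v) * (-2 * v * ψ v))
    (x₀ := t) (s := Metric.ball t 1) (bound := fun _ => Real.exp (2 * (|t| + 1)) * (2 * 4))
    (Metric.ball_mem_nhds t one_pos)
    (Eventually.of_forall fun t => (hmeas t).aestronglyMeasurable)
    (by
      refine (hint (Real.exp (2 * |t|) * 4)).mono' (hmeas t).aestronglyMeasurable ?_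
      refine (ae_restrict_iff' measurableSet_Ioo).2 (Eventually.of_forall fun v hv => ?_)
      rw [norm_mul, hexp]
      have := hb v hv
      refine mul_le_mul (Real.exp_le_exp.2 ?_) this (norm_nonneg _) (Real.exp_nonneg _)
      have := neg_abs_le t
      have := hv.1; have := hv.2
      nlinarith [abs_nonneg t])
    (by
      refine Measurable.aestronglyMeasurable ?_
      have : Measurable (fun v : ℝ => Complex.exp (-2 * t * v)) := by fun_prop
      have h2 : Measurable (fun v : ℝ => (-2 * v : ℂ)) := by fun_prop
      exact this.mul (h2.mul hm))
    (by
      refine (ae_restrict_iff' measurableSet_Ioo).2 (Eventually.of_forall fun v hv x hx => ?_)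
      rw [norm_mul, hexp, norm_mul]
      have := hb v hv
      have h2 : ‖(-2 * v : ℂ)‖ ≤ 2 := by
        rw [norm_mul, Complex.norm_real, Real.norm_of_nonneg hv.1.le]; simp; linarith [hv.2]
      refine mul_le_mul (Real.exp_le_exp.2 ?_) (mul_le_mul h2 this (norm_nonneg _) (by norm_num))
        (by positivity) (Real.exp_nonneg _)
      have hx' : |x| ≤ |t| + 1 := by
        rw [Metric.mem_ball, Real.dist_eq] at hx
        have := abs_sub_abs_le_abs_sub x t
        linarith
      have := neg_abs_le x
      have := hv.1; have := hv.2
      nlinarith [abs_nonneg x])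
    (hint _)
    (by
      refine Eventually.of_forall fun v x _ => ?_
      have h1 : HasDerivAt (fun x : ℝ => (-2 * x * v : ℂ)) (-2 * v) x := by
        have := ((hasDerivAt_id x).ofReal_comp.const_mul (-2:ℂ)).mul_const (v:ℂ)
        refine this.congr_deriv (by simp)
      refine (h1.cexp.mul_const (ψ v)).congr_deriv (by ring))
  exact key.2

/-- Laplace type asymptotics -/
lemma gM_lim (μ : ℝ) {χ : ℝ → ℂ} (hχ : Continuous χ) (hb : ∀ v ∈ Ioo (0:ℝ) 1, ‖χ v‖ ≤ 2) :
    Tendsto (fun t : ℝ => phM μ t * (t * gM (fun v => χ v * phM μ (v * (1 - v))) t)) atTop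
      (𝓝 (∫ x in Ioi (0:ℝ), χ 0 * (Complex.exp (-2 * x) * phM μ x))) := by
  have e1 : ∀ᶠ t : ℝ in atTop, ∫ x, (Ioo (0:ℝ) 1).indicator (fun v => phM μ t * (Complex.exp (-2 * t * v) * (χ v * phM μ (v * (1 - v))))) (t⁻¹ * x)
      = phM μ t * (t * gM (fun v => χ v * phM μ (v * (1 - v))) t) := by
    filter_upwards [eventually_gt_atTop 0] with t ht
    rw [Measure.integral_comp_mul_left, integral_indicator measurableSet_Ioo, integral_const_mul,
      inv_inv, abs_of_pos ht, Complex.real_smul, gM]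
    ring
  refine Tendsto.congr' e1 ?_
  rw [← integral_indicator measurableSet_Ioi]
  refine tendsto_integral_filter_of_dominated_convergence
    ((Ioi (0:ℝ)).indicator (fun x => 2 * Real.exp (-2 * x))) ?_ ?_ ?_ ?_
  · refine Eventually.of_forall fun t => ?_
    refine Measurable.aestronglyMeasurable ?_
    have : Measurable (fun v : ℝ => phM μ t * (Complex.exp (-2 * t * v) * (χ v * phM μ (v * (1 - v))))) := by
      have h1 : Measurable (fun v : ℝ => Complex.exp (-2 * t * v)) := by fun_prop
      have h2 : Measurable (fun v : ℝ => phM μ (v * (1 - v))) := (phM_meas μ).comp (by fun_prop)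
      exact (h1.mul (hχ.measurable.mul h2)).const_mul _
    exact (this.indicator measurableSet_Ioo).comp (by fun_prop)
  · filter_upwards [eventually_gt_atTop 0] with t ht
    refine Eventually.of_forall fun x => ?_
    by_cases hx : t⁻¹ * x ∈ Ioo (0:ℝ) 1
    · have hx0 : 0 < x := by
        have := hx.1
        exact pos_of_mul_pos_right this (by positivity)
      rw [indicator_of_mem hx, indicator_of_mem (by exact hx0)]
      rw [norm_mul, norm_mul, norm_mul, phM_norm, phM_norm, one_mul, mul_one, Complex.norm_exp]
      have := hb _ hx
      have e : (-2 * (t:ℂ) * ((t⁻¹ * x : ℝ) : ℂ)).re = -2 * x := by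
        have : (-2 * (t:ℂ) * ((t⁻¹ * x : ℝ) : ℂ)) = ((-2 * x : ℝ) : ℂ) := by
          push_cast
          have : (t:ℂ) ≠ 0 := by exact_mod_cast ht.ne'
          field_simp
        rw [this, Complex.ofReal_re]
      rw [e, mul_comm]
      gcongr
    · rw [indicator_of_notMem hx, norm_zero]
      exact indicator_nonneg (fun x _ => by positivity) x
  · rw [integrable_indicator_iff measurableSet_Ioi]
    exact (integrableOn_exp_mul_Ioi (by norm_num) 0).const_mul 2
  · refine Eventually.of_forall fun x => ?_
    by_cases hx : 0 < x
    · rw [indicator_of_mem (by exact hx)]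
      have hlim0 : Tendsto (fun t : ℝ => t⁻¹ * x) atTop (𝓝 0) := by
        simpa using tendsto_inv_atTop_zero.mul_const x
      have hlim : Tendsto (fun t : ℝ => χ (t⁻¹ * x) * (Complex.exp (-2 * x) * (phM μ (x * (1 - t⁻¹ * x)))))
          atTop (𝓝 (χ 0 * (Complex.exp (-2 * x) * phM μ x))) := by
        refine ((hχ.tendsto _).comp hlim0).mul (tendsto_const_nhds.mul ?_)
        have h1 : Tendsto (fun t : ℝ => x * (1 - t⁻¹ * x)) atTop (𝓝 x) := by
          simpa using (hlim0.const_sub 1).const_mul x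
        exact (phM_cont μ hx.ne').tendsto.comp h1
      refine hlim.congr' ?_
      filter_upwards [eventually_gt_atTop x] with t ht
      have ht0 : 0 < t := hx.trans ht
      have hlt : t⁻¹ * x < 1 := by
        rw [inv_mul_lt_iff₀ ht0]; linarith
      have hpos : 0 < t⁻¹ * x := by positivity
      rw [indicator_of_mem (show t⁻¹ * x ∈ Ioo (0:ℝ) 1 from ⟨hpos, hlt⟩)]
      have e2 : phM μ (x * (1 - t⁻¹ * x)) = phM μ t * phM μ (t⁻¹ * x * (1 - t⁻¹ * x)) := by
        rw [← phM_mul μ ht0 (mul_pos hpos (by linarith))]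
        congr 1; field_simp
      have e : (-2 * (t:ℂ) * ((t⁻¹ * x : ℝ) : ℂ)) = -2 * x := by
        push_cast
        have : (t:ℂ) ≠ 0 := by exact_mod_cast ht0.ne'
        field_simp
      rw [e2, e]
      ring
    · rw [indicator_of_notMem (by exact hx)]
      refine tendsto_const_nhds.congr' ?_
      filter_upwards [eventually_gt_atTop 0] with t ht
      rw [indicator_of_notMem]
      intro h
      exact hx (pos_of_mul_pos_right h.1 (by positivity))

lemma gM_ident (μ t : ℝ) :
    gM (fun v => (2 * (1 + Complex.I * μ) * (1 - 2 * v) - 4 * t * (v * (1 - v))) * phM μ (v * (1 - v))) t = 0 := by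
  set f : ℝ → ℂ := fun v => 2 * (Complex.exp (-2 * t * v) * ((v * (1 - v) : ℝ) * phM μ (v * (1 - v)))) with hf
  have hphd : ∀ y : ℝ, 0 < y → HasDerivAt (phM μ) (Complex.I * μ / y * phM μ y) y := fun y hy => by
    have h1 := ((Real.hasDerivAt_log hy.ne').const_mul μ).ofReal_comp
    refine ((h1.const_mul Complex.I).cexp).congr_deriv ?_
    simp only [phM]; push_cast; ring
  have hpc : Continuous (fun y : ℝ => (y : ℂ) * phM μ y) := by
    rw [continuous_iff_continuousAt]
    intro y
    by_cases hy : y = 0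
    · subst hy
      have : Tendsto (fun y : ℝ => (y : ℂ) * phM μ y) (𝓝 0) (𝓝 0) := by
        refine squeeze_zero_norm (a := fun y : ℝ => ‖y‖) (fun y => ?_) ?_
        · rw [norm_mul, phM_norm, mul_one, Complex.norm_real]
        · simpa using (continuous_norm (E := ℝ)).tendsto 0
      simpa [ContinuousAt] using this
    · exact Complex.continuous_ofReal.continuousAt.mul (phM_cont μ hy)
  have hfc : Continuous f := by
    refine continuous_const.mul (Continuous.mul (by fun_prop) ?_)
    exact hpc.comp (by fun_prop : Continuous fun v : ℝ => v * (1 - v))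
  set f' : ℝ → ℂ := fun v => Complex.exp (-2 * t * v) *
    ((2 * (1 + Complex.I * μ) * (1 - 2 * v) - 4 * t * (v * (1 - v))) * phM μ (v * (1 - v))) with hf'
  have hder : ∀ v ∈ Ioo (0:ℝ) 1, HasDerivAt f (f' v) v := fun v hv => by
    have hy : 0 < v * (1 - v) := mul_pos hv.1 (by linarith [hv.2])
    have h0 : HasDerivAt (fun v : ℝ => v * (1 - v)) (1 - 2 * v) v := by
      refine ((hasDerivAt_id v).mul ((hasDerivAt_id v).const_sub 1)).congr_deriv (by simp; ring)
    have h1 := (hphd _ hy).scomp v h0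
    have h2 := h0.ofReal_comp.mul h1
    have h3 : HasDerivAt (fun x : ℝ => (-2 * t * x : ℂ)) (-2 * t) v := by
      refine ((hasDerivAt_id v).ofReal_comp.const_mul (-2 * t:ℂ)).congr_deriv (by simp)
    refine ((h3.cexp.mul h2).const_mul 2).congr_deriv ?_
    have hyc : ((v:ℂ) * (1 - v)) ≠ 0 := by
      have : ((v * (1 - v) : ℝ) : ℂ) ≠ 0 := by exact_mod_cast hy.ne'
      simpa using this
    simp only [hf', Pi.mul_apply, Function.comp, Complex.real_smul]
    push_cast
    have e : (v:ℂ) * (1 - v) * ((1 - 2 * (v:ℂ)) * (Complex.I * μ / (v * (1 - v)) * phM μ (v * (1 - v))))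
      = (1 - 2 * (v:ℂ)) * (Complex.I * μ * phM μ (v * (1 - v))) := by
      generalize phM μ (v * (1 - v)) = p
      generalize (v:ℂ) * (1 - v) = q at *
      field_simp
    rw [e]
    ring
  have hint : IntervalIntegrable f' volume 0 1 := by
    rw [intervalIntegrable_iff_integrableOn_Ioo_of_le zero_le_one]
    have hc : Continuous (fun v : ℝ => Complex.exp (-2 * t * v) *
        (2 * (1 + Complex.I * μ) * (1 - 2 * v) - 4 * t * (v * (1 - v)))) := by fun_prop
    have h1 : IntegrableOn (fun v : ℝ => ‖Complex.exp (-2 * t * v) *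
        (2 * (1 + Complex.I * μ) * (1 - 2 * v) - 4 * t * (v * (1 - v)))‖) (Ioo 0 1) :=
      (hc.norm.integrableOn_Icc).mono_set Ioo_subset_Icc_self
    refine h1.mono' ?_ (Eventually.of_forall fun v => ?_)
    · refine Measurable.aestronglyMeasurable ?_
      have h2 : Measurable (fun v : ℝ => phM μ (v * (1 - v))) := (phM_meas μ).comp (by fun_prop)
      have h3 := hc.measurable.mul h2
      have e : f' = _ := funext fun v => (mul_assoc _ _ _).symm
      rw [e]
      exact h3
    · simp only [hf']
      rw [← mul_assoc, norm_mul _ (phM _ _), phM_norm, mul_one]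
  have := intervalIntegral.integral_eq_sub_of_hasDerivAt_of_le zero_le_one hfc.continuousOn hder hint
  rw [intervalIntegral.integral_of_le zero_le_one, integral_Ioc_eq_integral_Ioo] at this
  rw [gM, this]
  simp [hf]


lemma gM_int {ψ : ℝ → ℂ} (hm : Measurable ψ) (hb : ∀ v ∈ Ioo (0:ℝ) 1, ‖ψ v‖ ≤ 4) (t : ℝ) :
    IntegrableOn (fun v : ℝ => Complex.exp (-2 * t * v) * ψ v) (Ioo 0 1) := by
  have hc : Continuous (fun v : ℝ => Complex.exp (-2 * t * v)) := by fun_prop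
  have h1 : IntegrableOn (fun v : ℝ => ‖Complex.exp (-2 * t * v)‖ * 4) (Ioo 0 1) :=
    ((hc.norm.mul continuous_const).integrableOn_Icc).mono_set Ioo_subset_Icc_self
  refine h1.mono' (hc.measurable.mul hm).aestronglyMeasurable ?_
  refine (ae_restrict_iff' measurableSet_Ioo).2 (Eventually.of_forall fun v hv => ?_)
  rw [norm_mul]
  have := hb v hv
  gcongr

lemma gM_zero (μ : ℝ) : gM (fun v => phM μ (v * (1 - v))) 0 =
    Complex.Gamma (1 + Complex.I * μ) ^ 2 / Complex.Gamma (2 + 2 * Complex.I * μ) := by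
  have hre : 0 < (1 + Complex.I * μ).re := by simp
  have h := Complex.Gamma_mul_Gamma_eq_betaIntegral hre hre
  have hne : Complex.Gamma (2 + 2 * Complex.I * μ) ≠ 0 :=
    Complex.Gamma_ne_zero_of_re_pos (by simp)
  rw [eq_div_iff hne, sq, h, mul_comm]
  congr 1
  · congr 1; ring
  · rw [Complex.betaIntegral, intervalIntegral.integral_of_le zero_le_one, integral_Ioc_eq_integral_Ioo, gM]
    refine setIntegral_congr_fun measurableSet_Ioo fun v hv => ?_
    have h1 : 0 < 1 - v := by linarith [hv.2]
    rw [phM_mul μ hv.1 h1, phM_cpow μ hv.1, phM_cpow μ h1]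
    simp

lemma ginf (μ : ℝ) : ∫ x in Ioi (0:ℝ), (1:ℂ) * (Complex.exp (-2 * x) * phM μ x) =
    (1/2 : ℂ) ^ (1 + Complex.I * μ) * Complex.Gamma (1 + Complex.I * μ) := by
  have hre : 0 < (1 + Complex.I * μ).re := by simp
  have h := Complex.integral_cpow_mul_exp_neg_mul_Ioi hre (r := (2:ℝ)) two_pos
  rw [Complex.ofReal_ofNat] at h
  rw [← h]
  refine setIntegral_congr_fun measurableSet_Ioi fun v hv => ?_
  rw [phM_cpow μ hv]
  rw [one_mul, mul_comm]
  congr 2 <;> ring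

lemma model (μ : ℝ) : ∃ (U W : ℝ → ℂ) (c1 c2 : ℝ), 0 < c1 ∧
    (∀ t, 0 < t → HasDerivAt U (W t) t) ∧
    (∀ t : ℝ, 0 < t → HasDerivAt W (U t - 2 * Complex.I * μ / t * W t) t) ∧
    (∀ t, 0 < t → c1 * Real.exp t ≤ ‖U t‖) ∧ (∀ t, 0 < t → ‖U t‖ ≤ c2 * Real.exp t) ∧
    (∀ t, 0 < t → ‖W t‖ ≤ ‖U t‖) ∧
    (Tendsto U (𝓝[>] 0) (𝓝 1)) ∧ (Tendsto W (𝓝[>] 0) (𝓝 0)) ∧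
    (Tendsto (fun t => W t / U t) atTop (𝓝 1)) ∧
    Tendsto (fun t : ℝ => Complex.exp (-t) * phM μ (t/2) * U t) atTop
      (𝓝 (Complex.Gamma (1/2 + Complex.I * μ) / (2 * (√Real.pi : ℝ)))) := by
  set ψ0 : ℝ → ℂ := fun v => phM μ (v * (1 - v)) with hψ0
  set ψ1 : ℝ → ℂ := fun v => -2 * v * ψ0 v with hψ1
  set ψ2 : ℝ → ℂ := fun v => -2 * v * ψ1 v with hψ2
  have m0 : Measurable ψ0 := (phM_meas μ).comp (by fun_prop)
  have m2 : Measurable (fun v : ℝ => (-2 * v : ℂ)) := by fun_prop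
  have m1 : Measurable ψ1 := m2.mul m0
  have m3 : Measurable ψ2 := m2.mul m1
  have hv2 : ∀ v ∈ Ioo (0:ℝ) 1, ‖(-2 * v : ℂ)‖ ≤ 2 := fun v hv => by
    rw [norm_mul, Complex.norm_real, Real.norm_of_nonneg hv.1.le]; simp; linarith [hv.2]
  have n0 : ∀ v, ‖ψ0 v‖ = 1 := fun v => phM_norm _ _
  have b0 : ∀ v ∈ Ioo (0:ℝ) 1, ‖ψ0 v‖ ≤ 4 := fun v _ => by rw [n0]; norm_num
  have b1' : ∀ v ∈ Ioo (0:ℝ) 1, ‖ψ1 v‖ ≤ 2 := fun v hv => by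
    simp only [hψ1]; rw [norm_mul, n0, mul_one]; exact hv2 v hv
  have b1 : ∀ v ∈ Ioo (0:ℝ) 1, ‖ψ1 v‖ ≤ 4 := fun v hv => (b1' v hv).trans (by norm_num)
  have b2 : ∀ v ∈ Ioo (0:ℝ) 1, ‖ψ2 v‖ ≤ 4 := fun v hv => by
    simp only [hψ2]; rw [norm_mul]
    calc _ ≤ (2:ℝ) * 2 := mul_le_mul (hv2 v hv) (b1' v hv) (norm_nonneg _) (by norm_num)
      _ = 4 := by norm_num
  set G := gM ψ0 with hG
  set G1 := gM ψ1 with hG1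
  set G2 := gM ψ2 with hG2
  have dG : ∀ t, HasDerivAt G (G1 t) t := fun t => gM_deriv m0 b0 t
  have dG1 : ∀ t, HasDerivAt G1 (G2 t) t := fun t => gM_deriv m1 b1 t
  have ident : ∀ t : ℝ, (2 + 2 * Complex.I * μ) * G t + (2 + 2 * Complex.I * μ + 2 * t) * G1 t + t * G2 t = 0 := by
    intro t
    rw [← gM_ident μ t]
    simp only [hG, hG1, hG2, gM]
    rw [← integral_const_mul, ← integral_const_mul, ← integral_const_mul,
      ← integral_add, ← integral_add]
    · congr 1; ext v; simp only [hψ2, hψ1, hψ0]; ring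
    · exact ((gM_int m0 b0 t).const_mul _).add ((gM_int m1 b1 t).const_mul _)
    · exact ((gM_int m3 b2 t).const_mul _)
    · exact ((gM_int m0 b0 t).const_mul _)
    · exact ((gM_int m1 b1 t).const_mul _)
  have hΓ1 : Complex.Gamma (1 + Complex.I * μ) ≠ 0 := Complex.Gamma_ne_zero_of_re_pos (by simp)
  have hΓ2 : Complex.Gamma (2 + 2 * Complex.I * μ) ≠ 0 := Complex.Gamma_ne_zero_of_re_pos (by simp)
  have hone : (1 + 2 * Complex.I * μ : ℂ) ≠ 0 := fun h => by
    have := congrArg Complex.re h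
    simp at this
  have hG0 : G 0 = Complex.Gamma (1 + Complex.I * μ) ^ 2 / Complex.Gamma (2 + 2 * Complex.I * μ) :=
    gM_zero μ
  have hG0ne : G 0 ≠ 0 := by rw [hG0]; exact div_ne_zero (pow_ne_zero 2 hΓ1) hΓ2
  set C : ℂ := 1 / ((1 + 2 * Complex.I * μ) * G 0) with hC
  have hCne : C ≠ 0 := one_div_ne_zero (mul_ne_zero hone hG0ne)
  set W : ℝ → ℂ := fun t => C * (Complex.exp t * (t * G t)) with hW
  set U : ℝ → ℂ := fun t => C * (Complex.exp t * ((1 + 2 * Complex.I * μ + t) * G t + t * G1 t)) with hU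
  have dt : ∀ t : ℝ, HasDerivAt (fun t : ℝ => (t : ℂ)) 1 t := fun t => by
    simpa using (hasDerivAt_id t).ofReal_comp
  have de : ∀ t : ℝ, HasDerivAt (fun t : ℝ => Complex.exp t) (Complex.exp t) t := fun t => by
    simpa using (dt t).cexp
  have dU : ∀ t, HasDerivAt U (W t) t := fun t => by
    refine (((de t).mul ((((dt t).const_add (1 + 2 * Complex.I * μ)).mul (dG t)).add
      ((dt t).mul (dG1 t)))).const_mul C).congr_deriv ?_
    simp only [hW, Pi.mul_apply, Pi.add_apply]
    have := ident t
    linear_combination C * Complex.exp t * this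
  have dW : ∀ t : ℝ, HasDerivAt W (C * (Complex.exp t * ((1 + t) * G t + t * G1 t))) t := fun t => by
    refine (((de t).mul ((dt t).mul (dG t))).const_mul C).congr_deriv ?_
    simp only [Pi.mul_apply]
    ring
  have hWU : ∀ t : ℝ, t ≠ 0 → C * (Complex.exp t * ((1 + t) * G t + t * G1 t)) =
      U t - 2 * Complex.I * μ / t * W t := fun t ht => by
    have : (t:ℂ) ≠ 0 := by exact_mod_cast ht
    simp only [hU, hW]
    field_simp
    ring
  have hU0 : U 0 = 1 := by
    simp only [hU, hC]
    simp
    field_simp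
  have hW0 : W 0 = 0 := by simp [hW]
  have cons : ∀ t, 0 ≤ t → ‖U t‖^2 - ‖W t‖^2 = 1 := by
    intro t ht
    have hd : ∀ y, HasDerivAt (fun y => ‖U y‖^2 - ‖W y‖^2) 0 y := by
      intro y
      refine ((dU y).norm_sq.sub (dW y).norm_sq).congr_deriv ?_
      by_cases hy : y = 0
      · subst hy; rw [hW0]; simp
      · rw [hWU y hy, Complex.inner, Complex.inner]
        generalize U y = a
        generalize W y = b
        have e : (2 * Complex.I * μ / y : ℂ) = ((2 * μ / y : ℝ) : ℂ) * Complex.I := by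
          push_cast; ring
        rw [e]
        generalize (2 * μ / y) = r
        simp
        ring
    have := is_const_of_deriv_eq_zero (fun y => (hd y).differentiableAt) (fun y => (hd y).deriv) t 0
    rw [this, hU0, hW0]; simp
  have hUge : ∀ t, 0 ≤ t → 1 ≤ ‖U t‖ := fun t ht => by
    have := cons t ht
    nlinarith [norm_nonneg (U t), sq_nonneg ‖W t‖]
  have hWUle : ∀ t, 0 ≤ t → ‖W t‖ ≤ ‖U t‖ := fun t ht => by
    have := cons t ht
    refine le_of_sq_le_sq ?_ (norm_nonneg _)
    linarith
  -- asymptotics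
  have l0 : Tendsto (fun t : ℝ => phM μ t * (t * G t)) atTop
      (𝓝 ((1/2 : ℂ) ^ (1 + Complex.I * μ) * Complex.Gamma (1 + Complex.I * μ))) := by
    have := gM_lim μ (χ := fun _ => 1) continuous_const (fun _ _ => by simp)
    rw [ginf] at this
    simpa [hG, hψ0] using this
  have l1 : Tendsto (fun t : ℝ => phM μ t * (t * G1 t)) atTop (𝓝 0) := by
    have := gM_lim μ (χ := fun v => -2 * v) (by fun_prop) hv2
    simpa [hG1, hψ1, hψ0] using this
  set g := (1/2 : ℂ) ^ (1 + Complex.I * μ) * Complex.Gamma (1 + Complex.I * μ) with hg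
  have hgne : g ≠ 0 := by
    refine mul_ne_zero ?_ hΓ1
    rw [Complex.cpow_def_of_ne_zero (by norm_num)]
    exact Complex.exp_ne_zero _
  have linv : Tendsto (fun t : ℝ => (1 + 2 * Complex.I * μ) / (t : ℂ)) atTop (𝓝 0) := by
    have h1 : Tendsto (fun t : ℝ => ((t⁻¹ : ℝ) : ℂ)) atTop (𝓝 ((0:ℝ):ℂ)) :=
      (Complex.continuous_ofReal.tendsto _).comp tendsto_inv_atTop_zero
    have := h1.const_mul (1 + 2 * Complex.I * μ : ℂ)
    simpa [div_eq_mul_inv] using this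
  have lU : Tendsto (fun t : ℝ => Complex.exp (-t) * phM μ t * U t) atTop (𝓝 (C * g)) := by
    have := ((((linv.const_add 1).mul l0).add l1).const_mul C)
    rw [add_zero, add_zero, one_mul] at this
    refine this.congr' ?_
    filter_upwards [eventually_gt_atTop 0] with t ht
    have h1 : (t:ℂ) ≠ 0 := by exact_mod_cast ht.ne'
    have h2 : Complex.exp (-t) * Complex.exp t = 1 := by rw [← Complex.exp_add]; simp
    have h3 : (1 + (1 + 2 * Complex.I * μ) / (t : ℂ)) * t = 1 + 2 * Complex.I * μ + t := by
      field_simp; ring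
    simp only [hU]
    linear_combination (C * phM μ t * G t) * h3 - C * phM μ t * ((1 + 2 * Complex.I * μ + t) * G t + t * G1 t) * h2
  have lW : Tendsto (fun t : ℝ => Complex.exp (-t) * phM μ t * W t) atTop (𝓝 (C * g)) := by
    refine (l0.const_mul C).congr fun t => ?_
    have h2 : Complex.exp (-t) * Complex.exp t = 1 := by rw [← Complex.exp_add]; simp
    simp only [hW]
    linear_combination - C * phM μ t * (t * G t) * h2
  have hCg : C * g ≠ 0 := mul_ne_zero hCne hgne
  have hphne : ∀ t, phM μ t ≠ 0 := fun t h => by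
    have := phM_norm μ t
    rw [h, norm_zero] at this; norm_num at this
  have lUn : Tendsto (fun t : ℝ => ‖U t‖ * Real.exp (-t)) atTop (𝓝 ‖C * g‖) := by
    refine lU.norm.congr fun t => ?_
    rw [norm_mul, norm_mul, phM_norm, mul_one, Complex.norm_exp, mul_comm]
    simp
  have cUn : ∀ t, ContinuousAt (fun t : ℝ => ‖U t‖ * Real.exp (-t)) t := fun t =>
    (dU t).continuousAt.norm.mul (by fun_prop)
  obtain ⟨c2, hc2⟩ := bdd_Ici (fun t _ => cUn t) lUn
  have hpos : ∀ t, 0 ≤ t → 0 < ‖U t‖ * Real.exp (-t) := fun t ht =>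
    mul_pos (by linarith [hUge t ht]) (Real.exp_pos _)
  obtain ⟨c3, hc3⟩ := bdd_Ici (fun t ht => (cUn t).inv₀ (hpos t ht).ne') (lUn.inv₀ (norm_ne_zero_iff.2 hCg))
  have hc3pos : 0 < c3 := lt_of_lt_of_le (inv_pos.2 (hpos 0 le_rfl)) (hc3 0 le_rfl)
  refine ⟨U, W, c3⁻¹, c2, by positivity, fun t _ => dU t, fun t ht => ?_, fun t ht => ?_, fun t ht => ?_,
    fun t ht => hWUle t ht.le, ?_, ?_, ?_, ?_⟩
  · rw [← hWU t ht.ne']; exact dW t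
  · have h1 := hc3 t ht.le
    have h2 := inv_le_of_inv_le₀ (hpos t ht.le) h1
    rw [Real.exp_neg, ← div_eq_mul_inv, le_div_iff₀ (Real.exp_pos _)] at h2
    exact h2
  · have h1 := hc2 t ht.le
    rwa [Real.exp_neg, ← div_eq_mul_inv, div_le_iff₀ (Real.exp_pos _)] at h1
  · rw [← hU0]; exact (dU 0).continuousAt.tendsto.mono_left nhdsWithin_le_nhds
  · rw [← hW0]; exact (dW 0).continuousAt.tendsto.mono_left nhdsWithin_le_nhds
  · have := lW.div lU hCg
    rw [div_self hCg] at this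
    refine this.congr fun t => ?_
    have := Complex.exp_ne_zero (-t)
    have := hphne t
    simp only [Pi.div_apply]
    rw [mul_div_mul_left]
    exact mul_ne_zero (Complex.exp_ne_zero _) (hphne t)
  · have hval : C * g * phM μ (1/2) = Complex.Gamma (1/2 + Complex.I * μ) / (2 * (√Real.pi : ℝ)) := by
      have hdup := Complex.Gamma_mul_Gamma_add_half (1/2 + Complex.I * μ)
      rw [show (1/2 + Complex.I * μ + 1/2 : ℂ) = 1 + Complex.I * μ by ring,
        show (2 * (1/2 + Complex.I * μ) : ℂ) = 1 + 2 * Complex.I * μ by ring] at hdup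
      have hadd := Complex.Gamma_add_one (1 + 2 * Complex.I * μ) hone
      rw [show (1 + 2 * Complex.I * μ + 1 : ℂ) = 2 + 2 * Complex.I * μ by ring] at hadd
      have hpi : ((√Real.pi : ℝ) : ℂ) ≠ 0 := by
        exact_mod_cast (Real.sqrt_pos.2 Real.pi_pos).ne'
      have hpow : (2:ℂ) ^ (1 - (1 + 2 * Complex.I * μ)) = phM μ (1/2) * phM μ (1/2) := by
        rw [← phM_mul μ (by norm_num) (by norm_num), Complex.cpow_def_of_ne_zero (by norm_num), phM]
        have : Real.log (1/2 * (1/2)) = -2 * Real.log 2 := by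
          rw [Real.log_mul (by norm_num) (by norm_num), one_div, Real.log_inv]; ring
        rw [this]
        congr 1
        rw [show (2:ℂ) = ((2:ℝ):ℂ) by norm_num, ← Complex.ofReal_log (by norm_num)]
        push_cast; ring
      have hhalf : (1/2 : ℂ) ^ (1 + Complex.I * μ) = 1/2 * phM μ (1/2) := by
        rw [phM_cpow μ (by norm_num), Complex.cpow_add _ _ (by norm_num)]
        simp
      rw [hpow] at hdup
      have hΓ1' : Complex.Gamma (1 + 2 * Complex.I * μ) ≠ 0 := Complex.Gamma_ne_zero_of_re_pos (by simp)
      rw [hC, hg, hG0, hadd, hhalf]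
      generalize Complex.Gamma (1 / 2 + Complex.I * μ) = Γh at *
      field_simp
      linear_combination -hdup
    have := lU.mul_const (phM μ (1/2))
    rw [hval] at this
    refine this.congr' ?_
    filter_upwards [eventually_gt_atTop 0] with t ht
    rw [show t / 2 = t * (1/2) by ring, phM_mul μ ht (by norm_num)]
    ring


section ioi
variable {E : Type*} [NormedAddCommGroup E] [NormedSpace ℝ E] [CompleteSpace E]

lemma ioi_eq {f : ℝ → E} (hc : Continuous f) (hi : ∀ x, IntegrableOn f (Ioi x)) (x : ℝ) :
    ∫ y in Ioi x, f y = (∫ y in Ioi 0, f y) - ∫ y in (0:ℝ)..x, f y := by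
  rw [← intervalIntegral.integral_interval_add_Ioi (hi 0) (hi x)]
  abel

lemma ioi_deriv {f : ℝ → E} (hc : Continuous f) (hi : ∀ x, IntegrableOn f (Ioi x)) (x : ℝ) :
    HasDerivAt (fun x => ∫ y in Ioi x, f y) (-(f x)) x := by
  have h : (fun x => ∫ y in Ioi x, f y) = fun x => (∫ y in Ioi 0, f y) - ∫ y in (0:ℝ)..x, f y := by
    ext x; exact ioi_eq hc hi x
  rw [h]
  exact (hc.integral_hasStrictDerivAt 0 x).hasDerivAt.const_sub _

lemma ioi_top {f : ℝ → E} (hc : Continuous f) (hi : ∀ x, IntegrableOn f (Ioi x)) :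
    Tendsto (fun x => ∫ y in Ioi x, f y) atTop (𝓝 0) := by
  have h : (fun x => ∫ y in Ioi x, f y) = fun x => (∫ y in Ioi 0, f y) - ∫ y in (0:ℝ)..x, f y := by
    ext x; exact ioi_eq hc hi x
  rw [h]
  have := (intervalIntegral_tendsto_integral_Ioi 0 (hi 0) tendsto_id).const_sub (∫ y in Ioi 0, f y)
  rwa [sub_self] at this

lemma ioi_bot {f : ℝ → E} (hc : Continuous f) (hi : Integrable f) :
    Tendsto (fun x => ∫ y in Ioi x, f y) atBot (𝓝 (∫ y, f y)) := by
  have h : (fun x => ∫ y in Ioi x, f y) = fun x => (∫ y in Ioi 0, f y) + ∫ y in x..(0:ℝ), f y := by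
    ext x; rw [ioi_eq hc (fun x => hi.integrableOn) x, intervalIntegral.integral_symm, sub_eq_add_neg]
    simp
  rw [h]
  have := (intervalIntegral_tendsto_integral_Iic (0:ℝ) (hi.integrableOn (s := Iic 0)) tendsto_id).const_add (∫ y in Ioi 0, f y)
  rwa [add_comm (∫ y in Ioi 0, f y) (∫ y in Iic 0, f y),
    intervalIntegral.integral_Iic_add_Ioi hi.integrableOn hi.integrableOn] at this
end ioi

lemma step {a s : ℝ → ℝ} {f φ : ℝ → ℂ} (hs' : ∀ x, HasDerivAt s (-(a x)) x)
    (hsl : Tendsto s atTop (𝓝 0)) (hfc : Continuous f) (hfn : ∀ x, ‖f x‖ = a x) (hφ : Continuous φ) (k : ℕ)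
    (hb : ∀ x, ‖φ x‖ ≤ s x ^ k / k.factorial) (hi : Integrable (fun x => f x * φ x)) :
    Continuous (fun x => ∫ y in Ioi x, f y * φ y) ∧
    ∀ x, ‖∫ y in Ioi x, f y * φ y‖ ≤ s x ^ (k+1) / (k+1).factorial := by
  have hc : Continuous fun x => f x * φ x := hfc.mul hφ
  have hd := ioi_deriv hc (fun x => hi.integrableOn)
  refine ⟨continuous_iff_continuousAt.2 fun x => (hd x).continuousAt, fun x => ?_⟩
  have := DB (f := fun x => ∫ y in Ioi x, f y * φ y) (x0 := x) (L := 0)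
    (G := fun x => s x ^ (k+1) / (k+1).factorial) (g := fun x => a x * (s x ^ k / k.factorial)) (G0 := 0)
    (fun y _ => hd y) (fun y _ => ?_) (fun y _ => ?_) (ioi_top hc (fun x => hi.integrableOn)) ?_
  · simpa using this
  · refine (((hs' y).pow (k+1)).div_const _).congr_deriv ?_
    rw [Nat.factorial_succ]
    have : (k.factorial : ℝ) ≠ 0 := by positivity
    push_cast
    field_simp
    try simp
  · rw [norm_neg, norm_mul, hfn]
    exact mul_le_mul_of_nonneg_left (hb y) (by rw [← hfn]; positivity)
  · have := (hsl.pow (k+1)).div_const ((k+1).factorial : ℝ)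
    simpa using this

lemma swap {f : ℝ → ℂ} {φ : ℕ → ℝ → ℂ} {b : ℕ → ℝ} (hfc : Continuous f) (hfi : Integrable f)
    (hφ : ∀ n, Continuous (φ n)) (hb : ∀ n x, ‖φ n x‖ ≤ b n) (hs : Summable b) :
    Continuous (fun x => ∑' n, φ n x) ∧ (∀ x, ‖∑' n, φ n x‖ ≤ ∑' n, b n) ∧
    Integrable (fun x => f x * ∑' n, φ n x) ∧
    ∀ x, HasSum (fun n => ∫ y in Ioi x, f y * φ n y) (∫ y in Ioi x, f y * ∑' n, φ n y) := by
  have hc := continuous_tsum hφ hs hb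
  have hB : ∀ x, ‖∑' n, φ n x‖ ≤ ∑' n, b n := fun x => tsum_of_norm_bounded hs.hasSum (fun n => hb n x)
  have hI : ∀ n, Integrable (fun x => f x * φ n x) := fun n =>
    hfi.mul_bdd (hφ n).aestronglyMeasurable (Eventually.of_forall (hb n))
  refine ⟨hc, hB, hfi.mul_bdd hc.aestronglyMeasurable (Eventually.of_forall hB), fun x => ?_⟩
  have := hasSum_integral_of_summable_integral_norm (μ := volume.restrict (Ioi x)) (F := fun n y => f y * φ n y)
    (fun n => (hI n).integrableOn) ?_
  · simpa [tsum_mul_left] using this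
  · refine Summable.of_nonneg_of_le (fun n => integral_nonneg fun _ => norm_nonneg _) (fun n => ?_)
      (hs.mul_left (∫ y in Ioi x, ‖f y‖))
    rw [← integral_mul_const]
    refine integral_mono (hI n).norm.integrableOn (hfi.norm.mul_const _).integrableOn fun y => ?_
    simp only [norm_mul]
    exact mul_le_mul_of_nonneg_left (hb n y) (norm_nonneg _)

noncomputable def ellF (q : ℝ → ℂ) (lam : ℝ) : ℕ → ℝ → ℂ
  | 0, _ => Complex.I
  | n+1, y => ∫ t in Ioi y, q t * mL3 q lam n t

lemma mL3_eq (q : ℝ → ℂ) (lam : ℝ) (n : ℕ) (x : ℝ) : mL3 q lam n x =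
    Complex.exp (-2 * Complex.I * lam * x) *
      ∫ y in Ioi x, (Complex.exp (2 * Complex.I * lam * y) * (starRingEnd ℂ) (q y)) * ellF q lam n y := by
  have he : ∀ y : ℝ, Complex.exp (2 * Complex.I * lam * (y - x)) =
      Complex.exp (-2 * Complex.I * lam * x) * Complex.exp (2 * Complex.I * lam * y) := fun y => by
    rw [← Complex.exp_add]; congr 1; ring
  cases n with
  | zero =>
    simp only [mL3, ellF]
    rw [← integral_const_mul, ← integral_const_mul]
    congr 1; ext y; rw [he]; ring
  | succ n =>
    simp only [mL3, ellF]
    rw [← integral_const_mul]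
    congr 1; ext y; rw [he, ← integral_const_mul, ← integral_const_mul]
    congr 1; ext t; ring

lemma series {q : ℝ → ℂ} (hqc : Continuous q) (hqi : Integrable q) (lam z : ℝ) :
    ∃ u : ℝ → ℂ, (∀ x, HasDerivAt u (Complex.I * z * (q x * ML3 q lam x z)) x) ∧
      (∀ x, HasDerivAt (fun x => ML3 q lam x z)
        (-2 * Complex.I * lam * ML3 q lam x z - Complex.I * z * ((starRingEnd ℂ) (q x) * u x)) x) ∧
      Tendsto u atTop (𝓝 1) ∧ Tendsto (fun x => ML3 q lam x z) atTop (𝓝 0) ∧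
      Tendsto u atBot (𝓝 (aL1 q lam z)) ∧ ∃ B, ∀ x, ‖ML3 q lam x z‖ ≤ B := by
  set a : ℝ → ℝ := fun x => ‖q x‖ with ha
  set s : ℝ → ℝ := fun x => ∫ y in Ioi x, a y with hs
  have hac : Continuous a := hqc.norm
  have hai : Integrable a := hqi.norm
  have hs' : ∀ x, HasDerivAt s (-(a x)) x := ioi_deriv hac (fun x => hai.integrableOn)
  have hsl : Tendsto s atTop (𝓝 0) := ioi_top hac (fun x => hai.integrableOn)
  set S := ∫ y, a y with hS
  have hs0 : ∀ x, 0 ≤ s x := fun x => integral_nonneg fun _ => norm_nonneg _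
  have hsS : ∀ x, s x ≤ S := fun x => setIntegral_le_integral hai (Eventually.of_forall fun _ => norm_nonneg _)
  set e : ℝ → ℂ := fun y => Complex.exp (2 * Complex.I * lam * y) with he
  have hec : Continuous e := by fun_prop
  have hen : ∀ y, ‖e y‖ = 1 := fun y => by
    rw [he]; simp only; rw [Complex.norm_exp]; simp
  have hen' : ∀ y : ℝ, ‖Complex.exp (-2 * Complex.I * lam * y)‖ = 1 := fun y => by
    rw [Complex.norm_exp]; simp
  set f : ℝ → ℂ := fun y => e y * (starRingEnd ℂ) (q y) with hf
  have hfc : Continuous f := hec.mul (Complex.continuous_conj.comp hqc)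
  have hfn : ∀ y, ‖f y‖ = a y := fun y => by simp [hf, hen, ha]
  have hfi : Integrable f := hai.mono' hfc.aestronglyMeasurable (Eventually.of_forall fun y => (hfn y).le)
  have bdS : ∀ {φ : ℝ → ℂ} {k : ℕ}, (∀ x, ‖φ x‖ ≤ s x ^ k / k.factorial) → ∀ x, ‖φ x‖ ≤ S ^ k / k.factorial := by
    intro φ k h x
    refine (h x).trans ?_
    gcongr
    · exact hsS x
  have inte : ∀ {g φ : ℝ → ℂ} {k : ℕ}, Integrable g → Continuous φ → (∀ x, ‖φ x‖ ≤ s x ^ k / k.factorial) →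
      Integrable (fun x => g x * φ x) := fun hg hφ h =>
    hg.mul_bdd hφ.aestronglyMeasurable (Eventually.of_forall (bdS h))
  have stepM : ∀ n, (Continuous (ellF q lam n) ∧ ∀ x, ‖ellF q lam n x‖ ≤ s x ^ (2*n) / (2*n).factorial) →
      (Continuous (mL3 q lam n) ∧ ∀ x, ‖mL3 q lam n x‖ ≤ s x ^ (2*n+1) / (2*n+1).factorial) := by
    rintro n ⟨h1, h2⟩
    obtain ⟨h3, h4⟩ := step hs' hsl hfc hfn h1 _ h2 (inte hfi h1 h2)
    have h5 : mL3 q lam n = fun x : ℝ => Complex.exp (-2 * Complex.I * lam * x) * ∫ y in Ioi x, f y * ellF q lam n y := by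
      ext x; exact mL3_eq q lam n x
    refine ⟨?_, fun x => ?_⟩
    · rw [h5]; exact Continuous.mul (by fun_prop) h3
    · rw [h5]; simp only; rw [norm_mul, hen', one_mul]; exact h4 x
  have key : ∀ n, (Continuous (ellF q lam n) ∧ ∀ x, ‖ellF q lam n x‖ ≤ s x ^ (2*n) / (2*n).factorial) := by
    intro n
    induction n with
    | zero => exact ⟨continuous_const, fun x => by simp [ellF]⟩
    | succ n ih =>
      obtain ⟨h1, h2⟩ := stepM n ih
      exact step hs' hsl hqc (fun _ => rfl) h1 _ h2 (inte hqi h1 h2)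
  have keyM := fun n => stepM n (key n)
  -- summability
  have hsum : Summable (fun n : ℕ => (|z| * S) ^ (2*n+1) / (2*n+1).factorial) :=
    (Real.summable_pow_div_factorial (|z| * S)).comp_injective (i := fun n : ℕ => 2*n+1)
      (fun m n h => by simp only at h; omega)
  have hsumE : Summable (fun n : ℕ => |z| * ((|z| * S) ^ (2*n) / (2*n).factorial)) :=
    ((Real.summable_pow_div_factorial (|z| * S)).comp_injective (i := fun n : ℕ => 2*n)
      (fun m n h => by simp only at h; omega)).mul_left _
  have hb1 : ∀ n x, ‖mL3 q lam n x * (z:ℂ)^(2*n+1)‖ ≤ (|z| * S) ^ (2*n+1) / (2*n+1).factorial := by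
    intro n x
    rw [norm_mul, norm_pow, Complex.norm_real, Real.norm_eq_abs, mul_pow]
    have := bdS (keyM n).2 x
    calc _ ≤ S ^ (2*n+1) / (2*n+1).factorial * |z|^(2*n+1) := by gcongr
      _ = _ := by ring
  have hb2 : ∀ n x, ‖ellF q lam n x * (z:ℂ)^(2*n+1)‖ ≤ |z| * ((|z| * S) ^ (2*n) / (2*n).factorial) := by
    intro n x
    rw [norm_mul, norm_pow, Complex.norm_real, Real.norm_eq_abs, mul_pow]
    have := bdS (key n).2 x
    calc _ ≤ S ^ (2*n) / (2*n).factorial * |z|^(2*n+1) := by gcongr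
      _ = _ := by ring
  obtain ⟨c1, b1, i1, s1⟩ := swap (φ := fun n x => mL3 q lam n x * (z:ℂ)^(2*n+1)) hqc hqi
    (fun n => (keyM n).1.mul continuous_const) hb1 hsum
  obtain ⟨c2, b2, i2, s2⟩ := swap (φ := fun n x => ellF q lam n x * (z:ℂ)^(2*n+1)) hfc hfi
    (fun n => (key n).1.mul continuous_const) hb2 hsumE
  have hM : ∀ x, ∑' n, mL3 q lam n x * (z:ℂ)^(2*n+1) = ML3 q lam x z := fun x => rfl
  simp only [hM] at c1 b1 i1 s1
  set u : ℝ → ℂ := fun x => 1 - Complex.I * z * ∫ y in Ioi x, q y * ML3 q lam y z with hu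
  have hcq : Continuous (fun y => q y * ML3 q lam y z) := hqc.mul c1
  have hEll : ∀ x, ∑' n, ellF q lam n x * (z:ℂ)^(2*n+1) = Complex.I * z * u x := by
    intro x
    have h1 : HasSum (fun n => ellF q lam (n+1) x * (z:ℂ)^(2*(n+1)+1))
        ((∫ y in Ioi x, q y * ML3 q lam y z) * z^2) := by
      have h0 := (s1 x).mul_right ((z:ℂ)^2)
      have h00 : (fun n => ellF q lam (n+1) x * (z:ℂ)^(2*(n+1)+1)) =
          fun n => (∫ y in Ioi x, q y * (mL3 q lam n y * (z:ℂ)^(2*n+1))) * (z:ℂ)^2 := by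
        ext n
        simp only [ellF]
        rw [← integral_mul_const, ← integral_mul_const]
        congr 1; ext y; ring
      rw [h00]; exact h0
    have h3 : Summable (fun n => ellF q lam n x * (z:ℂ)^(2*n+1)) :=
      Summable.of_norm_bounded hsumE (fun n => hb2 n x)
    rw [h3.tsum_eq_zero_add, h1.tsum_eq]
    simp only [ellF, hu]
    linear_combination (z^2 * (∫ y in Ioi x, q y * ML3 q lam y z)) * Complex.I_sq
  have hMeq : (fun x => ML3 q lam x z) = fun x : ℝ => Complex.exp (-2 * Complex.I * lam * x) *
      ∫ y in Ioi x, f y * (Complex.I * z * u y) := by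
    ext x
    simp only [hEll] at s2
    rw [← (s2 x).tsum_eq, ← tsum_mul_left, ← hM]
    congr 1; ext n
    rw [mL3_eq, mul_assoc, ← integral_mul_const]
    congr 2; ext y; simp only [hf]; ring
  simp only [hEll] at i2 c2
  have hcf : Continuous (fun y => f y * (Complex.I * z * u y)) := hfc.mul c2
  refine ⟨u, fun x => ?_, fun x => ?_, ?_, ?_, ?_, _, b1⟩
  · refine (((ioi_deriv hcq (fun x => i1.integrableOn) x).const_mul (Complex.I * z)).const_sub 1).congr_deriv ?_
    ring
  · have hex : HasDerivAt (fun x : ℝ => Complex.exp (-2 * Complex.I * lam * x))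
        (Complex.exp (-2 * Complex.I * lam * x) * (-2 * Complex.I * lam * 1)) x := by
      have : HasDerivAt (fun t : ℝ => (t : ℂ)) 1 x := by simpa using (hasDerivAt_id x).ofReal_comp
      exact (this.const_mul _).cexp
    have hval := congrFun hMeq x
    rw [hMeq, hval]
    refine (hex.mul (ioi_deriv hcf (fun x => i2.integrableOn) x)).congr_deriv ?_
    have h2 : Complex.exp (-2 * Complex.I * lam * x) * e x = 1 := by
      rw [he]; simp only; rw [← Complex.exp_add]; ring_nf; simp
    simp only [hf]
    linear_combination (- (starRingEnd ℂ) (q x) * Complex.I * z * u x) * h2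
  · have := ((ioi_top hcq (fun x => i1.integrableOn)).const_mul (Complex.I * z)).const_sub 1
    simpa using this
  · have := ioi_top hcf (fun x => i2.integrableOn)
    rw [hMeq]
    rw [tendsto_zero_iff_norm_tendsto_zero] at this ⊢
    refine this.congr fun x => ?_
    rw [norm_mul, hen', one_mul]
  · exact ((ioi_bot hcq i1).const_mul (Complex.I * z)).const_sub 1


lemma tz {g : ℝ → ℝ} {p r : ℝ} (h : Asymptotics.IsBigO atTop g (fun x => Real.exp (-p * x))) (hr : r < p) :
    Tendsto (fun x => g x * Real.exp (r * x)) atTop (𝓝 0) := by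
  have h1 := h.mul (Asymptotics.isBigO_refl (fun x => Real.exp (r * x)) atTop)
  refine h1.trans_tendsto ?_
  have : Tendsto (fun x => Real.exp (-((p - r) * x))) atTop (𝓝 0) :=
    Real.tendsto_exp_neg_atTop_nhds_zero.comp (tendsto_id.const_mul_atTop (by linarith))
  refine this.congr fun x => ?_
  rw [← Real.exp_add]; congr 1; ring

lemma endl (k α Ω lam : ℝ) (hk : 0 < k) (hα : 0 < α) (a c : ℝ → ℝ) (ha : ∀ x, 0 < a x) (hac : Continuous a)
    (hai : Integrable a)
    (has : Asymptotics.IsBigO atTop (fun x => a x - α * Real.exp (-k * x)) (fun x => Real.exp (-(3*k) * x)))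
    (hcc : Continuous c)
    (hcs : Asymptotics.IsBigO atTop (fun x => c x - Ω) (fun x => Real.exp (-(2*k) * x)))
    (u w : ℝ → ℝ → ℂ)
    (hu : ∀ z x : ℝ, HasDerivAt (u z) (-z * a x * w z x) x)
    (hw : ∀ z x : ℝ, HasDerivAt (w z) (2 * Complex.I * (c x - lam : ℝ) * w z x - z * a x * u z x) x)
    (hul : ∀ z, Tendsto (u z) atTop (𝓝 1)) (hwl : ∀ z, Tendsto (w z) atTop (𝓝 0)) (μ : ℝ) (hμ : μ = (Ω - lam)/k) (L : ℂ)
    (hL : L = Complex.Gamma (1/2 + Complex.I * μ) / (2 * (√Real.pi : ℝ)) *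
      Complex.exp (-(Complex.I * ((∫ x in Ioi (0:ℝ), (c x - Ω)) + μ * Real.log (α / k) : ℝ)))) :
    Tendsto (fun z : ℝ => u z 0 * Complex.exp (-(z * (∫ x in Ioi (0:ℝ), a x : ℝ))) * phM μ (z/2)) atTop (𝓝 L) ∧
    Tendsto (fun z : ℝ => w z 0 * Complex.exp (-(z * (∫ x in Ioi (0:ℝ), a x : ℝ))) * phM μ (z/2)) atTop (𝓝 L) := by
  set s : ℝ → ℝ := fun x => ∫ y in Ioi x, a y with hs
  have hs' : ∀ x, HasDerivAt s (-(a x)) x := ioi_deriv hac (fun x => hai.integrableOn)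
  have hsl : Tendsto s atTop (𝓝 0) := ioi_top hac (fun x => hai.integrableOn)
  have hs0 : ∀ x, 0 ≤ s x := fun x => integral_nonneg fun y => (ha y).le
  have hsanti : StrictAnti s := strictAnti_of_hasDerivAt_neg hs' (fun x => by linarith [ha x])
  have hspos : ∀ x, 0 < s x := fun x => lt_of_le_of_lt (hs0 (x+1)) (hsanti (by linarith))
  have hci : ∀ x, IntegrableOn (fun x => c x - Ω) (Ioi x) := fun x =>
    integrable_of_isBigO_exp_neg (b := 2*k) (by linarith) (by fun_prop) (by simpa using hcs)
  have hccΩ : Continuous (fun x => c x - Ω) := by fun_prop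
  set J : ℝ → ℝ := fun x => ∫ y in Ioi x, (c y - Ω) with hJ
  have hJ' : ∀ x, HasDerivAt J (-(c x - Ω)) x := ioi_deriv hccΩ hci
  have hJl : Tendsto J atTop (𝓝 0) := ioi_top hccΩ hci
  -- asymptotics of s
  have hexp : ∀ b x : ℝ, HasDerivAt (fun x => Real.exp (b * x)) (Real.exp (b * x) * b) x := fun b x => by
    have := ((hasDerivAt_id x).const_mul b).exp
    simpa using this
  have hel : ∀ b : ℝ, b < 0 → Tendsto (fun x => Real.exp (b * x)) atTop (𝓝 0) := fun b hb =>
    Real.tendsto_exp_atBot.comp (tendsto_id.const_mul_atTop_of_neg hb)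
  have hss : Asymptotics.IsBigO atTop (fun x => s x - α/k * Real.exp (-k * x)) (fun x => Real.exp (-(3*k) * x)) := by
    obtain ⟨B, hB⟩ := has.bound
    obtain ⟨X, hX⟩ := eventually_atTop.1 hB
    refine Asymptotics.IsBigO.of_bound (B / (3*k)) ?_
    filter_upwards [eventually_ge_atTop X] with x hx
    have := DB (f := fun x => ((s x - α/k * Real.exp (-k * x) : ℝ) : ℂ)) (x0 := x) (L := 0)
      (G := fun x => B / (3*k) * Real.exp (-(3*k) * x)) (g := fun x => B * Real.exp (-(3*k) * x)) (G0 := 0)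
      (f' := fun y => ((-(a y - α * Real.exp (-k * y)) : ℝ) : ℂ))
      (fun y _ => ?_) (fun y _ => ?_) (fun y hy => ?_) ?_ ?_
    · rw [sub_zero, sub_zero, Complex.norm_real] at this
      rw [Real.norm_of_nonneg (Real.exp_pos _).le]
      exact this
    · refine HasDerivAt.ofReal_comp ?_
      refine ((hs' y).sub ((hexp (-k) y).const_mul (α/k))).congr_deriv ?_
      field_simp; ring
    · refine ((hexp (-(3*k)) y).const_mul (B/(3*k))).congr_deriv ?_
      field_simp
    · rw [Complex.norm_real, norm_neg]
      have := hX y (hx.trans hy)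
      rwa [Real.norm_of_nonneg (Real.exp_pos _).le] at this
    · have := hsl.sub ((hel (-k) (by linarith)).const_mul (α/k))
      have := (Complex.continuous_ofReal.tendsto _).comp this
      rw [mul_zero, sub_zero, Complex.ofReal_zero] at this
      exact this
    · have := (hel (-(3*k)) (by linarith)).const_mul (B/(3*k))
      simpa using this
  have ee : ∀ x, Real.exp (-k * x) * Real.exp (k * x) = 1 := fun x => by
    rw [← Real.exp_add]; simp
  have hsk : Tendsto (fun x => s x * Real.exp (k * x)) atTop (𝓝 (α/k)) := by
    have := (tz hss (r := k) (by linarith)).add_const (α/k)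
    rw [zero_add] at this
    refine this.congr fun x => ?_
    linear_combination (-α/k) * ee x
  have hak : Tendsto (fun x => a x * Real.exp (k * x)) atTop (𝓝 α) := by
    have := (tz has (r := k) (by linarith)).add_const α
    rw [zero_add] at this
    refine this.congr fun x => ?_
    linear_combination (-α) * ee x
  have hαk : 0 < α/k := by positivity
  set R : ℝ → ℝ := fun x => J x + μ * Real.log (α/k) - μ * Real.log (s x) - μ * k * x with hR
  have hR' : ∀ x, HasDerivAt R (-((c x - lam) - μ * a x / s x)) x := fun x => by
    refine (((((hJ' x).add_const (μ * Real.log (α/k))).sub (((hs' x).log (hspos x).ne').const_mul μ)).sub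
      ((hasDerivAt_id x).const_mul (μ*k)))).congr_deriv ?_
    rw [hμ]; field_simp; ring
  have hRl : Tendsto R atTop (𝓝 0) := by
    have h1 := (Real.continuousAt_log hαk.ne').tendsto.comp hsk
    have h2 := (hJl.add_const (μ * Real.log (α/k))).sub (h1.const_mul μ)
    rw [zero_add, sub_self] at h2
    refine h2.congr fun x => ?_
    simp only [Function.comp, hR]
    rw [Real.log_mul (hspos x).ne' (Real.exp_pos _).ne', Real.log_exp]
    ring
  have hHl : Tendsto (fun x => |(c x - lam) - μ * a x / s x| / a x) atTop (𝓝 0) := by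
    have h1 := tz hcs (r := k) (by linarith)
    have h2 := tz hss (r := 2*k) (by linarith)
    have h3 := tz has (r := 2*k) (by linarith)
    have h4 := ((h1.add ((((h2.const_mul k).sub h3).const_mul μ).div hsk hαk.ne')).div hak hα.ne').abs
    simp only [mul_zero, sub_zero, zero_div, add_zero, abs_zero] at h4
    refine h4.congr fun x => ?_
    have hE := Real.exp_pos (k * x)
    have hE' := ee x
    have e2 : Real.exp (2*k*x) = Real.exp (k*x) * Real.exp (k*x) := by rw [← Real.exp_add]; ring_nf
    have hA := ha x
    have hS := hspos x
    rw [← abs_of_pos (ha x), ← abs_div, abs_of_pos (ha x)]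
    congr 1
    simp only [Pi.div_apply]
    rw [e2, hμ]
    have e3 : Real.exp (-k * x) = (Real.exp (k * x))⁻¹ := eq_inv_of_mul_eq_one_left hE'
    rw [e3]
    generalize Real.exp (k * x) = E at *
    field_simp
    ring
  have hHc : ∀ x, 0 ≤ x → ContinuousAt (fun x => |(c x - lam) - μ * a x / s x| / a x) x := fun x _ => by
    have h1 := hac.continuousAt (x := x)
    have h2 := (hs' x).continuousAt
    have h3 := hcc.continuousAt (x := x)
    exact (((h3.sub continuousAt_const).sub ((continuousAt_const.mul h1).div h2 (hspos x).ne')).abs).div h1 (ha x).ne'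
  obtain ⟨M, hM⟩ := bdd_Ici hHc hHl
  have hM0 : 0 ≤ M := le_trans (div_nonneg (abs_nonneg _) (ha 0).le) (hM 0 le_rfl)
  obtain ⟨U, W, c1, c2, hc1, m1, m2, m3, m4, m5, m6, m7, m8, m9⟩ := model μ
  obtain ⟨r1, r2⟩ := half μ M c1 c2 hM0 hc1 U W m1 m2 m3 m4 m5 m6 m7 m8 a (fun x => c x - lam) s R ha hspos hs' hsl
    hR' hRl (fun x hx => by have := hM x hx; rwa [div_le_iff₀ (ha x)] at this) u w hu hw hul hwl
  have hUne : ∀ t, 0 < t → U t ≠ 0 := fun t ht h => by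
    have := m3 t ht
    rw [h, norm_zero] at this
    have : 0 < c1 * Real.exp t := by positivity
    linarith
  have m10 : Tendsto (fun z : ℝ => Complex.exp (-((z * s 0 : ℝ):ℂ)) * phM μ (z * s 0/2) * U (z * s 0)) atTop _ :=
    m9.comp (tendsto_id.atTop_mul_const (hspos 0))
  have fin : ∀ v : ℝ → ℂ, Tendsto (fun z => Complex.exp (Complex.I * R 0) * v z / U (z * s 0)) atTop (𝓝 1) →
      Tendsto (fun z : ℝ => v z * Complex.exp (-(z * (s 0 : ℝ))) * phM μ (z/2)) atTop (𝓝 L) := by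
    intro v hv
    have h1 := (hv.mul m10).mul_const (Complex.exp (-(Complex.I * (J 0 + μ * Real.log (α / k) : ℝ))))
    rw [one_mul, ← hL] at h1
    refine h1.congr' ?_
    filter_upwards [eventually_gt_atTop 0] with z hz
    have h2 := hUne (z * s 0) (mul_pos hz (hspos 0))
    rw [show z * s 0 / 2 = (z/2) * s 0 by ring, phM_mul μ (by positivity) (hspos 0)]
    have h3 : Complex.exp (Complex.I * R 0) * phM μ (s 0) *
        Complex.exp (-(Complex.I * (J 0 + μ * Real.log (α / k) : ℝ))) = 1 := by
      rw [phM, ← Complex.exp_add, ← Complex.exp_add, ← Complex.exp_zero]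
      congr 1
      simp only [hR]
      push_cast
      ring
    have h4 : ((z * s 0 : ℝ) : ℂ) = z * (s 0 : ℝ) := by push_cast; ring
    rw [h4]
    have h5 := mul_inv_cancel₀ h2
    rw [div_eq_mul_inv]
    generalize Complex.exp (Complex.I * R 0) = e1 at *
    generalize Complex.exp (-(z * (s 0 : ℝ))) = e2 at *
    generalize Complex.exp (-(Complex.I * (J 0 + μ * Real.log (α / k) : ℝ))) = e3 at *
    linear_combination (v z * phM μ (z/2) * e2) * h3 + (v z * phM μ (z/2) * e2 * e1 * phM μ (s 0) * e3) * h5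
  exact ⟨fin _ r1, fin _ r2⟩


lemma sol {a c C : ℝ → ℝ} (hac : Continuous a) (hai : Integrable a) (hC : ∀ x, HasDerivAt C (c x) x) (q : ℝ → ℂ)
    (hq : ∀ x, q x = a x * Complex.exp (2 * Complex.I * (C x : ℝ))) (lam : ℝ) :
    ∃ u w : ℝ → ℝ → ℂ,
    (∀ z x : ℝ, HasDerivAt (u z) (-z * a x * w z x) x) ∧
    (∀ z x : ℝ, HasDerivAt (w z) (2 * Complex.I * (c x - lam : ℝ) * w z x - z * a x * u z x) x) ∧
    (∀ z, Tendsto (u z) atTop (𝓝 1)) ∧ (∀ z, Tendsto (w z) atTop (𝓝 0)) ∧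
    (∀ z : ℝ, Tendsto (u z) atBot (𝓝 (aL1 q lam z))) ∧ (∀ z, ∃ B, ∀ x, ‖w z x‖ ≤ B) := by
  set e : ℝ → ℂ := fun x => Complex.exp (2 * Complex.I * (C x : ℝ)) with he
  have hen : ∀ x, ‖e x‖ = 1 := fun x => by
    simp only [he]; rw [Complex.norm_exp]; simp
  have hed : ∀ x, HasDerivAt e (e x * (2 * Complex.I * (c x : ℝ))) x := fun x =>
    ((hC x).ofReal_comp.const_mul _).cexp
  have hec : Continuous e := continuous_iff_continuousAt.2 fun x => (hed x).continuousAt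
  have hqe : q = fun x => a x * e x := by ext x; exact hq x
  have hqc : Continuous q := by rw [hqe]; exact (Complex.continuous_ofReal.comp hac).mul hec
  have hqi : Integrable q := by
    refine hai.norm.mono' hqc.aestronglyMeasurable (Eventually.of_forall fun x => ?_)
    rw [hqe]; simp [hen]
  have hee : ∀ x, (starRingEnd ℂ) (e x) * e x = 1 := fun x => by
    rw [mul_comm, Complex.mul_conj, Complex.normSq_eq_norm_sq, hen]; simp
  choose u h1 h2 h3 h4 h5 h6 using series hqc hqi lam
  refine ⟨u, fun z x => -Complex.I * (e x * ML3 q lam x z), fun z x => ?_, fun z x => ?_, h3, fun z => ?_, h5, fun z => ?_⟩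
  · refine (h1 z x).congr_deriv ?_
    rw [hqe]; ring
  · refine (((hed x).mul (h2 z x)).const_mul (-Complex.I)).congr_deriv ?_
    have hq' : (starRingEnd ℂ) (q x) = a x * (starRingEnd ℂ) (e x) := by rw [hqe]; simp
    rw [hq']
    push_cast
    linear_combination (Complex.I^2 * z * a x * u z x) * hee x + (z * a x * u z x) * Complex.I_sq
  · have := h4 z
    rw [tendsto_zero_iff_norm_tendsto_zero] at this ⊢
    refine this.congr fun x => ?_
    simp [hen]
  · obtain ⟨B, hB⟩ := h6 z
    exact ⟨B, fun x => by simpa [hen] using hB x⟩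

lemma pairing {a d : ℝ → ℝ} {z : ℝ} {u w u' w' : ℝ → ℂ} {l : ℂ}
    (hu : ∀ x : ℝ, HasDerivAt u (-z * a x * w x) x)
    (hw : ∀ x : ℝ, HasDerivAt w (2 * Complex.I * d x * w x - z * a x * u x) x)
    (hu' : ∀ x : ℝ, HasDerivAt u' (-z * a (-x) * w' x) x)
    (hw' : ∀ x : ℝ, HasDerivAt w' (2 * Complex.I * d (-x) * w' x - z * a (-x) * u' x) x)
    (hl : Tendsto u atBot (𝓝 l)) (hB : ∃ B, ∀ x, ‖w x‖ ≤ B)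
    (hul : Tendsto u' atTop (𝓝 1)) (hwl : Tendsto w' atTop (𝓝 0)) :
    l = u' 0 * u 0 + w' 0 * w 0 := by
  set P : ℝ → ℂ := fun x => u' (-x) * u x + w' (-x) * w x with hP
  have hPd : ∀ x, HasDerivAt P 0 x := fun x => by
    have k1 := (hu' (-x)).scomp x (hasDerivAt_neg x)
    have k2 := (hw' (-x)).scomp x (hasDerivAt_neg x)
    refine ((k1.mul (hu x)).add (k2.mul (hw x))).congr_deriv ?_
    simp only [Function.comp, neg_neg, neg_smul, one_smul]
    ring
  have hconst : ∀ x, P x = P 0 := fun x =>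
    is_const_of_deriv_eq_zero (fun y => (hPd y).differentiableAt) (fun y => (hPd y).deriv) x 0
  obtain ⟨B, hB⟩ := hB
  have l1 : Tendsto P atBot (𝓝 (1 * l + 0)) := by
    refine ((hul.comp tendsto_neg_atBot_atTop).mul hl).add ?_
    have := hwl.comp tendsto_neg_atBot_atTop
    exact this.zero_mul_isBoundedUnder_le (isBoundedUnder_of ⟨B, hB⟩)
  have l2 : Tendsto P atBot (𝓝 (P 0)) := tendsto_const_nhds.congr fun x => (hconst x).symm
  have := tendsto_nhds_unique l1 l2
  simpa [hP] using this

end helpers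

theorem stmt18
    (kappam kappap aminus aplus : ℝ)
    (hkm : 0 < kappam) (hkp : kappap < 0) (ham : 0 < aminus) (hap : 0 < aplus)
    (a : ℝ → ℝ) (ha_pos : ∀ x, 0 < a x) (ha_C1 : ContDiff ℝ 1 a)
    (ha_m : Asymptotics.IsBigO atBot
      (fun x => a x - aminus * Real.exp (kappam * x)) (fun x => Real.exp (3 * kappam * x)))
    (ha'_m : Asymptotics.IsBigO atBot
      (fun x => deriv a x - aminus * kappam * Real.exp (kappam * x))
      (fun x => Real.exp (3 * kappam * x)))
    (ha_p : Asymptotics.IsBigO atTop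
      (fun x => a x - aplus * Real.exp (kappap * x)) (fun x => Real.exp (3 * kappap * x)))
    (ha'_p : Asymptotics.IsBigO atTop
      (fun x => deriv a x - aplus * kappap * Real.exp (kappap * x))
      (fun x => Real.exp (3 * kappap * x)))
    (ha_int : Integrable a)
    (c : ℝ → ℝ) (hc_C1 : ContDiff ℝ 1 c) (Omegam Omegap : ℝ)
    (hc_m : Asymptotics.IsBigO atBot (fun x => c x - Omegam) (fun x => Real.exp (2 * kappam * x)))
    (hc'_m : Asymptotics.IsBigO atBot (fun x => deriv c x) (fun x => Real.exp (2 * kappam * x)))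
    (hc_p : Asymptotics.IsBigO atTop (fun x => c x - Omegap) (fun x => Real.exp (2 * kappap * x)))
    (hc'_p : Asymptotics.IsBigO atTop (fun x => deriv c x) (fun x => Real.exp (2 * kappap * x)))
    (lam K : ℝ) :
    Asymptotics.IsEquivalent atTop
      (fun z : ℝ => aL1 (qfun a c Omegam K) lam (z : ℂ))
      (fun z : ℝ =>
        Complex.exp (-(Complex.I * ((betaC c Omegam Omegap : ℝ) : ℂ))) /
            ((2 * Real.pi : ℝ) : ℂ) *
          ((-kappap / aplus : ℝ) : ℂ) ^ (Complex.I * (((lam - Omegap) / kappap : ℝ) : ℂ)) *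
          ((kappam / aminus : ℝ) : ℂ) ^ (-(Complex.I * (((lam - Omegam) / kappam : ℝ) : ℂ))) *
          Complex.Gamma (1 / 2 - Complex.I * (((lam - Omegam) / kappam : ℝ) : ℂ)) *
          Complex.Gamma (1 / 2 + Complex.I * (((lam - Omegap) / kappap : ℝ) : ℂ)) *
          ((z / 2 : ℝ) : ℂ) ^
            (Complex.I * (((lam - Omegam) / kappam - (lam - Omegap) / kappap : ℝ) : ℂ)) *
          Complex.exp ((z : ℂ) * ((∫ x : ℝ, a x : ℝ) : ℂ))) := by
  have hac := ha_C1.continuous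
  have hcc := hc_C1.continuous
  have hgc : Continuous (fun x => c x - Omegam) := by fun_prop
  have hcs_m : Asymptotics.IsBigO atTop (fun x => c (-x) - Omegam) (fun x => Real.exp (-(2*kappam) * x)) := by
    have := hc_m.comp_tendsto tendsto_neg_atTop_atBot
    simp only [Function.comp_def, mul_neg, ← neg_mul] at this
    simpa using this
  have has_m : Asymptotics.IsBigO atTop (fun x => a (-x) - aminus * Real.exp (-kappam * x))
      (fun x => Real.exp (-(3*kappam) * x)) := by
    have := ha_m.comp_tendsto tendsto_neg_atTop_atBot
    simp only [Function.comp_def, mul_neg, ← neg_mul] at this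
    simpa using this
  have has_p : Asymptotics.IsBigO atTop (fun x => a x - aplus * Real.exp (-(-kappap) * x))
      (fun x => Real.exp (-(3*(-kappap)) * x)) := by
    simpa using ha_p
  have hcs_p : Asymptotics.IsBigO atTop (fun x => c x - Omegap) (fun x => Real.exp (-(2*(-kappap)) * x)) := by
    simpa using hc_p
  have hgr : Continuous (fun x => c (-x) - Omegam) := by fun_prop
  have hgi : ∀ x, IntegrableOn (fun x => c (-x) - Omegam) (Ioi x) := fun x =>
    integrable_of_isBigO_exp_neg (b := 2*kappam) (by linarith) (by fun_prop) (by simpa using hcs_m)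
  have hneg : ∀ x, ∫ s in Iic x, (c s - Omegam) = ∫ s in Ioi (-x), (c (-s) - Omegam) := fun x => by
    rw [integral_comp_neg_Ioi (-x) (fun s => c s - Omegam), neg_neg]
  have hC : ∀ x, HasDerivAt (Cfun c Omegam K) (c x) x := fun x => by
    have h1 := (ioi_deriv hgr hgi (-x)).scomp x (hasDerivAt_neg x)
    have h2 : Cfun c Omegam K = fun x => ((fun x => ∫ y in Ioi x, (c (-y) - Omegam)) ∘ Neg.neg) x + Omegam * x + K := by
      ext x; simp only [Cfun, hneg, Function.comp]
    rw [h2]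
    refine ((h1.add ((hasDerivAt_id x).const_mul Omegam)).add_const K).congr_deriv ?_
    simp
  have hCr : ∀ x, HasDerivAt (fun x => -(Cfun c Omegam K (-x))) (c (-x)) x := fun x => by
    refine ((hC (-x)).scomp x (hasDerivAt_neg x)).neg.congr_deriv ?_
    simp
  obtain ⟨u, w, s1, s2, s3, s4, s5, s6⟩ := sol hac ha_int hC (qfun a c Omegam K) (fun x => rfl) lam
  obtain ⟨u', w', t1, t2, t3, t4, t5, t6⟩ := sol (a := fun x => a (-x)) (c := fun x => c (-x)) (hac.comp continuous_neg)
    ha_int.comp_neg hCr _ (fun x => rfl) lam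
  have hpair : ∀ z : ℝ, aL1 (qfun a c Omegam K) lam z = u' z 0 * u z 0 + w' z 0 * w z 0 := fun z =>
    pairing (d := fun x => c x - lam) (s1 z) (s2 z) (t1 z) (t2 z) (s5 z) (s6 z) (t3 z) (t4 z)
  set μp : ℝ := (lam - Omegap) / kappap with hμp
  set μm : ℝ := -((lam - Omegam) / kappam) with hμm
  obtain ⟨e1, e2⟩ := endl (-kappap) aplus Omegap lam (by linarith) hap a c ha_pos hac ha_int has_p hcc hcs_p u w s1 s2 s3 s4
    μp (by rw [hμp]; field_simp; ring) _ rfl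
  obtain ⟨f1, f2⟩ := endl kappam aminus Omegam lam hkm ham (fun x => a (-x)) (fun x => c (-x)) (fun x => ha_pos _)
    (hac.comp continuous_neg) ha_int.comp_neg has_m (hcc.comp continuous_neg) hcs_m u' w' t1 t2 t3 t4
    μm (by rw [hμm]; field_simp; ring) _ rfl
  have hA : ∫ x, a x = (∫ x in Ioi (0:ℝ), a (-x)) + ∫ x in Ioi (0:ℝ), a x := by
    have := integral_comp_neg_Ioi 0 a
    rw [this, neg_zero, intervalIntegral.integral_Iic_add_Ioi ha_int.integrableOn ha_int.integrableOn]
  have hβ : betaC c Omegam Omegap = (∫ x in Ioi (0:ℝ), (c (-x) - Omegam)) + ∫ x in Ioi (0:ℝ), (c x - Omegap) := by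
    rw [betaC, hneg, neg_zero]
  have lim := (f1.mul e1).add (f2.mul e2)
  rw [hA, hβ]
  generalize (∫ x in Ioi (0:ℝ), a (-x)) = A1 at *
  generalize (∫ x in Ioi (0:ℝ), a x) = A2 at *
  generalize (∫ x in Ioi (0:ℝ), (c (-x) - Omegam)) = J1 at *
  generalize (∫ x in Ioi (0:ℝ), (c x - Omegap)) = J2 at *
  have eμ : ((lam - Omegam) / kappam - μp : ℝ) = -(μm + μp) := by rw [hμm]; ring
  have eμ2 : (lam - Omegam) / kappam = -μm := by rw [hμm]; ring
  rw [eμ, eμ2]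
  have g1 : Complex.Gamma (1 / 2 - Complex.I * ((-μm : ℝ) : ℂ)) = Complex.Gamma (1 / 2 + Complex.I * μm) := by
    congr 1; push_cast; ring
  have g2 : -(Complex.I * ((-μm : ℝ) : ℂ)) = Complex.I * μm := by push_cast; ring
  rw [g1, g2, ← phM_cpow μp (div_pos (by linarith) hap), ← phM_cpow μm (div_pos hkm ham)]
  have hΓp : Complex.Gamma (1 / 2 + Complex.I * μp) ≠ 0 := Complex.Gamma_ne_zero_of_re_pos (by simp)
  have hΓm : Complex.Gamma (1 / 2 + Complex.I * μm) ≠ 0 := Complex.Gamma_ne_zero_of_re_pos (by simp)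
  generalize Complex.Gamma (1 / 2 + Complex.I * μp) = Γp at *
  generalize Complex.Gamma (1 / 2 + Complex.I * μm) = Γm at *
  have hpi : ((√Real.pi : ℝ) : ℂ) ^ 2 = (Real.pi : ℂ) := by
    rw [← Complex.ofReal_pow, Real.sq_sqrt Real.pi_pos.le]
  have hpi0 : ((√Real.pi : ℝ) : ℂ) ≠ 0 := by
    exact_mod_cast (Real.sqrt_pos.2 Real.pi_pos).ne'
  have hpp : phM μp (-kappap / aplus) = Complex.exp (-(Complex.I * (μp * Real.log (aplus / -kappap) : ℝ))) := by
    rw [phM, ← inv_div aplus, Real.log_inv]; congr 1; push_cast; ring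
  have hpm : phM μm (kappam / aminus) = Complex.exp (-(Complex.I * (μm * Real.log (aminus / kappam) : ℝ))) := by
    rw [phM, ← inv_div aminus, Real.log_inv]; congr 1; push_cast; ring
  rw [hpp, hpm]
  generalize Real.log (aplus / -kappap) = lp at *
  generalize Real.log (aminus / kappam) = lm at *
  set T : ℂ := Complex.exp (-(Complex.I * (J1 + J2 : ℝ))) / ((2 * Real.pi : ℝ) : ℂ) *
      Complex.exp (-(Complex.I * (μp * lp : ℝ))) * Complex.exp (-(Complex.I * (μm * lm : ℝ))) * Γm * Γp with hT
  have hTne : T ≠ 0 := by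
    have : ((2 * Real.pi : ℝ) : ℂ) ≠ 0 := by exact_mod_cast (by positivity : (2 * Real.pi : ℝ) ≠ 0)
    simp only [hT]
    exact mul_ne_zero (mul_ne_zero (mul_ne_zero (mul_ne_zero (div_ne_zero (Complex.exp_ne_zero _) this)
      (Complex.exp_ne_zero _)) (Complex.exp_ne_zero _)) hΓm) hΓp
  have hzp : ∀ z : ℝ, 0 < z → (((z / 2 : ℝ) : ℂ) ^ (Complex.I * ((-(μm + μp) : ℝ) : ℂ)) *
      Complex.exp ((z : ℂ) * ((A1 + A2 : ℝ) : ℂ))) *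
      (Complex.exp (-(z * A1)) * phM μm (z/2) * (Complex.exp (-(z * A2)) * phM μp (z/2))) = 1 := by
    intro z hz
    rw [← phM_cpow _ (by positivity : 0 < z/2), phM, phM, phM]
    simp only [← Complex.exp_add]
    rw [← Complex.exp_zero]
    congr 1; push_cast; ring
  have limval : Γm / (2 * (√Real.pi : ℝ)) * Complex.exp (-(Complex.I * (J1 + μm * lm : ℝ))) *
      (Γp / (2 * (√Real.pi : ℝ)) * Complex.exp (-(Complex.I * (J2 + μp * lp : ℝ)))) +
      Γm / (2 * (√Real.pi : ℝ)) * Complex.exp (-(Complex.I * (J1 + μm * lm : ℝ))) *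
      (Γp / (2 * (√Real.pi : ℝ)) * Complex.exp (-(Complex.I * (J2 + μp * lp : ℝ)))) = T := by
    have h1 : Complex.exp (-(Complex.I * (J1 + μm * lm : ℝ))) * Complex.exp (-(Complex.I * (J2 + μp * lp : ℝ))) =
        Complex.exp (-(Complex.I * (J1 + J2 : ℝ))) * Complex.exp (-(Complex.I * (μp * lp : ℝ))) *
        Complex.exp (-(Complex.I * (μm * lm : ℝ))) := by
      simp only [← Complex.exp_add]
      congr 1; push_cast; ring
    simp only [hT]
    generalize Complex.exp (-(Complex.I * (J1 + μm * lm : ℝ))) = x1 at *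
    generalize Complex.exp (-(Complex.I * (J2 + μp * lp : ℝ))) = x2 at *
    generalize Complex.exp (-(Complex.I * (J1 + J2 : ℝ))) = x3 at *
    generalize Complex.exp (-(Complex.I * (μp * lp : ℝ))) = x4 at *
    generalize Complex.exp (-(Complex.I * (μm * lm : ℝ))) = x5 at *
    rw [Complex.ofReal_mul, Complex.ofReal_ofNat, ← hpi]
    field_simp
    linear_combination (2:ℂ) * h1
  rw [limval] at lim
  refine Asymptotics.isEquivalent_of_tendsto_one ?_
  have lim2 := lim.div_const T
  rw [div_self hTne] at lim2
  refine lim2.congr' ?_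
  filter_upwards [eventually_gt_atTop 0] with z hz
  have h1 := hzp z hz
  simp only [Pi.div_apply, hpair]
  have hPE := left_ne_zero_of_mul_eq_one h1
  generalize ((z / 2 : ℝ) : ℂ) ^ (Complex.I * ((-(μm + μp) : ℝ) : ℂ)) = P at *
  generalize Complex.exp ((z : ℂ) * ((A1 + A2 : ℝ) : ℂ)) = E at *
  rw [eq_div_iff (mul_ne_zero (mul_ne_zero hTne (left_ne_zero_of_mul hPE)) (right_ne_zero_of_mul hPE)),
    div_mul_eq_mul_div, div_eq_iff hTne]
  linear_combination ((u' z 0 * u z 0 + w' z 0 * w z 0) * T) * h1
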